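/- Fix a positive integer k and set d = (k+1)^2 + 1. For every ε > 0 there exists Q such that for every prime power q ≥ Q the following holds, with n = q^{k+1}: if f_1, …, f_n are chosen independently and uniformly at random from F_q[X_1,…,X_{k+1}]_{≤d}, then with probability at least 1 − ε, both of the following hold simultaneously: (i) for every k-element subset T ⊆ {1,…,n}, the number of points x ∈ F_q^{k+1} with f_i(x) = 0 for all i ∈ T is at least q/2; and (ii) for every (k+1)-element subset T ⊆ {1,…,n}, the number of points x ∈ F_q^{k+1} with f_i(x) = 0 for all i ∈ T is at most d^{k+1}. -/

import Mathlib

lemma ht_poly1 {A : Type*} [CommRing A] [IsNoetherianRing A] (P : Ideal (Polynomial A)) [P.IsPrime] :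
   (P.comap Polynomial.C).height ≤ P.height := by
  have hL : P.LiesOver (P.comap Polynomial.C) := ⟨rfl⟩
  have := Ideal.height_eq_height_add_of_liesOver_of_hasGoingDown (P.comap Polynomial.C) (P := P)
  rw [this]
  exact le_self_add

lemma ht_poly2 {A : Type*} [CommRing A] [IsNoetherianRing A] (P : Ideal (Polynomial A)) [P.IsPrime]
   (h : P ≠ (P.comap Polynomial.C).map Polynomial.C) :
   (P.comap Polynomial.C).height + 1 ≤ P.height := by
  set p := P.comap Polynomial.C with hp
  have hpp : p.IsPrime := by rw [hp]; infer_instance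
  have : (p.map Polynomial.C).IsPrime := Ideal.isPrime_map_C_of_isPrime
  have h1 := ht_poly1 (p.map Polynomial.C)
  have h2 : (p.map Polynomial.C).comap Polynomial.C = p := by
    ext x
    rw [Ideal.mem_comap, Ideal.mem_map_C_iff]
    constructor
    · intro h; simpa using h 0
    · intro h n
      rw [Polynomial.coeff_C]; split_ifs
      · exact h
      · exact p.zero_mem
  rw [h2] at h1
  have hlt : p.map Polynomial.C < P := lt_of_le_of_ne (Ideal.map_comap_le) (Ne.symm h)
  calc p.height + 1 ≤ (p.map Polynomial.C).height + 1 := by gcongr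
    _ ≤ P.height := Ideal.height_add_one_le_of_lt_of_isPrime hlt

lemma indep_vars {F : Type*} [Field F] (n : ℕ) (P : Ideal (MvPolynomial (Fin n) F)) [hP : P.IsPrime] :
    ∃ S : Finset (Fin n), (n : ℕ∞) ≤ S.card + P.height ∧
      ∀ g ∈ P, (∀ m ∈ g.support, ∀ i, m i ≠ 0 → i ∈ S) → g = 0 := by
  induction n with
  | zero =>
    refine ⟨∅, by simp, fun g hg _ => ?_⟩
    by_contra hne
    obtain ⟨c, rfl⟩ := MvPolynomial.C_surjective (Fin 0) g
    have hc : c ≠ 0 := by rintro rfl; simp at hne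
    exact hP.ne_top (Ideal.eq_top_of_isUnit_mem _ hg ((isUnit_iff_ne_zero.2 hc).map MvPolynomial.C))
  | succ n ih =>
    let e := (MvPolynomial.finSuccEquiv F n).toRingEquiv
    set P' : Ideal (Polynomial (MvPolynomial (Fin n) F)) := P.comap e.symm with hP'
    have hmem : ∀ g, g ∈ P → MvPolynomial.finSuccEquiv F n g ∈ P' := by
      intro g hg
      rw [hP', Ideal.mem_comap]
      have : e.symm (MvPolynomial.finSuccEquiv F n g) = g := e.symm_apply_apply g
      rwa [this]
    have hPr : P'.IsPrime := by rw [hP']; infer_instance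
    have hh : P'.height = P.height := RingEquiv.height_comap e.symm P
    set p := P'.comap Polynomial.C with hp
    have hpp : p.IsPrime := by rw [hp]; infer_instance
    obtain ⟨S, hS, hS2⟩ := ih p
    by_cases hc : P' = p.map Polynomial.C
    · refine ⟨insert 0 (S.map (Fin.succEmb n)), ?_, ?_⟩
      · rw [Finset.card_insert_of_notMem (by simp), Finset.card_map, ← hh]
        have := ht_poly1 P'
        push_cast
        calc (n : ℕ∞) + 1 ≤ S.card + p.height + 1 := by gcongr
          _ ≤ S.card + P'.height + 1 := by gcongr
          _ = _ := by ring
      · intro g hg hsup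
        have h1 := hmem g hg
        rw [hc, Ideal.mem_map_C_iff] at h1
        apply (MvPolynomial.finSuccEquiv F n).injective
        rw [map_zero]
        ext1 j
        rw [Polynomial.coeff_zero]
        apply hS2 _ (h1 j)
        intro m hm i hi
        rw [MvPolynomial.mem_support_coeff_finSuccEquiv] at hm
        have := hsup _ hm i.succ (by simpa using hi)
        simpa using this
    · refine ⟨S.map (Fin.succEmb n), ?_, ?_⟩
      · rw [Finset.card_map, ← hh]
        have := ht_poly2 P' hc
        push_cast
        calc (n : ℕ∞) + 1 ≤ S.card + p.height + 1 := by gcongr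
          _ = S.card + (p.height + 1) := by ring
          _ ≤ S.card + P'.height := by gcongr
      · intro g hg hsup
        have h1 := hmem g hg
        have h0 : MvPolynomial.finSuccEquiv F n g = Polynomial.C ((MvPolynomial.finSuccEquiv F n g).coeff 0) := by
          ext1 j
          rw [Polynomial.coeff_C]
          split_ifs with hj
          · rw [hj]
          · by_contra hne
            obtain ⟨m, hm⟩ := MvPolynomial.support_nonempty.2 hne
            rw [MvPolynomial.mem_support_coeff_finSuccEquiv] at hm
            have := hsup _ hm 0 (by simpa using hj)
            simp at this
        have h2 : (MvPolynomial.finSuccEquiv F n g).coeff 0 ∈ p := by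
          rw [hp, Ideal.mem_comap, ← h0]; exact h1
        have h3 := hS2 _ h2 (by
          intro m hm i hi
          rw [MvPolynomial.mem_support_coeff_finSuccEquiv] at hm
          have := hsup _ hm i.succ (by simpa using hi)
          simpa using this)
        apply (MvPolynomial.finSuccEquiv F n).injective
        rw [h0, h3]; simp


section

open MvPolynomial

lemma mono_ct (n D : ℕ) : Nat.card {m : Fin n →₀ ℕ | (m.sum fun _ e => e) ≤ D} ≤ (D + n).choose n := by
  classical
  have h1 : ((Finset.univ : Finset (Fin (n+1))).finsuppAntidiag D).card = (D + n).choose n := by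
    rw [Finset.card_finsuppAntidiag_nat_eq_choose]
    simp
    rw [add_comm n D]
    exact Nat.choose_symm_add
  rw [← h1, ← Nat.card_eq_finsetCard]
  let φ : {m : Fin n →₀ ℕ | (m.sum fun _ e => e) ≤ D} → ((Finset.univ : Finset (Fin (n+1))).finsuppAntidiag D) :=
    fun m => ⟨Finsupp.cons (D - (m.1.sum fun _ e => e)) m.1, by
      have := m.2
      simp only [Set.mem_ofPred_eq] at this
      rw [Finset.mem_finsuppAntidiag]
      refine ⟨?_, by simp⟩
      rw [Fin.sum_univ_succ]
      simp only [Finsupp.cons_zero, Finsupp.cons_succ]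
      rw [Finsupp.sum_fintype _ _ (by simp)] at *
      omega⟩
  apply Nat.card_le_card_of_injective φ
  intro a b hab
  have := congrArg (fun z => Finsupp.tail z.1) hab
  simpa [φ, Finsupp.tail_cons, Subtype.ext_iff] using this

variable {F : Type*} [Field F] {n : ℕ}

noncomputable def hf (I : Ideal (MvPolynomial (Fin n) F)) (D : ℕ) : ℕ :=
  Module.finrank F ((restrictTotalDegree (Fin n) F D).map (Ideal.Quotient.mkₐ F I).toLinearMap)

lemma rtd_mono {D E : ℕ} (h : D ≤ E) : restrictTotalDegree (Fin n) F D ≤ restrictTotalDegree (Fin n) F E := by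
  intro p hp
  rw [mem_restrictTotalDegree] at *
  omega

lemma hf_mono (I : Ideal (MvPolynomial (Fin n) F)) {D E : ℕ} (h : D ≤ E) : hf I D ≤ hf I E :=
  Submodule.finrank_mono (Submodule.map_mono (rtd_mono h))

lemma hf_anti {I J : Ideal (MvPolynomial (Fin n) F)} (h : I ≤ J) (D : ℕ) : hf J D ≤ hf I D := by
  have : ((restrictTotalDegree (Fin n) F D).map (Ideal.Quotient.mkₐ F J).toLinearMap) =
     ((restrictTotalDegree (Fin n) F D).map (Ideal.Quotient.mkₐ F I).toLinearMap).map
       (Ideal.Quotient.factorₐ F h).toLinearMap := by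
    rw [← Submodule.map_comp]
    rfl
  rw [hf, this]
  exact Submodule.finrank_map_le _ _

lemma hf_le (I : Ideal (MvPolynomial (Fin n) F)) (D : ℕ) : hf I D ≤ (D + n).choose n := by
  refine (Submodule.finrank_map_le _ _).trans ?_
  refine le_trans (le_of_eq ?_) (mono_ct n D)
  exact Module.finrank_eq_nat_card_basis (basisRestrictSupport F {m : Fin n →₀ ℕ | (m.sum fun _ e => e) ≤ D})

lemma hf_step (I : Ideal (MvPolynomial (Fin n) F)) (f : MvPolynomial (Fin n) F) (d : ℕ) (hd : f.totalDegree ≤ d)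
    (hf' : ∀ g, f * g ∈ I → g ∈ I) (D : ℕ) :
    hf (I ⊔ Ideal.span {f}) (D + d) + hf I D ≤ hf I (D + d) := by
  set M := ((restrictTotalDegree (Fin n) F (D+d)).map (Ideal.Quotient.mkₐ F I).toLinearMap) with hM
  set N := ((restrictTotalDegree (Fin n) F D).map (Ideal.Quotient.mkₐ F I).toLinearMap) with hN
  set φ := (Ideal.Quotient.factorₐ F (le_sup_left : I ≤ I ⊔ Ideal.span {f})).toLinearMap with hφ
  have e1 : ((restrictTotalDegree (Fin n) F (D+d)).map (Ideal.Quotient.mkₐ F (I ⊔ Ideal.span {f})).toLinearMap) = LinearMap.range (φ.domRestrict M) := by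
    rw [LinearMap.range_domRestrict, hM, ← Submodule.map_comp]
    rfl
  have e2 := LinearMap.finrank_range_add_finrank_ker (φ.domRestrict M)
  have e3 : hf I D ≤ Module.finrank F (LinearMap.ker (φ.domRestrict M)) := by
    let μ : (MvPolynomial (Fin n) F ⧸ I) →ₗ[F] (MvPolynomial (Fin n) F ⧸ I) := LinearMap.mulLeft F (Ideal.Quotient.mk I f)
    have hNM : ∀ x ∈ N, μ x ∈ M := by
      rintro _ ⟨g, hg, rfl⟩
      refine ⟨f * g, ?_, by simp [μ]⟩
      simp only [SetLike.mem_coe, mem_restrictTotalDegree] at *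
      exact (totalDegree_mul _ _).trans (by omega)
    let ν : N →ₗ[F] LinearMap.ker (φ.domRestrict M) :=
      LinearMap.codRestrict _ (LinearMap.codRestrict M (μ.domRestrict N) (fun x => hNM x x.2)) (by
        rintro ⟨_, ⟨g, hg, rfl⟩⟩
        rw [LinearMap.mem_ker]
        show (Ideal.Quotient.mk (I ⊔ Ideal.span {f})) (f * g) = 0
        rw [Ideal.Quotient.eq_zero_iff_mem]
        exact Ideal.mul_mem_right _ _ (Ideal.mem_sup_right (Ideal.mem_span_singleton_self f)))
    apply LinearMap.finrank_le_finrank_of_injective (f := ν)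
    rw [injective_iff_map_eq_zero]
    rintro ⟨_, ⟨g, hg, rfl⟩⟩ h
    have h2 : (Ideal.Quotient.mk I) (f * g) = 0 := by
      have := congrArg (fun z : LinearMap.ker (φ.domRestrict M) => ((z : M) : MvPolynomial (Fin n) F ⧸ I)) h
      exact this
    rw [Ideal.Quotient.eq_zero_iff_mem] at h2
    ext
    exact Ideal.Quotient.eq_zero_iff_mem.2 (hf' _ h2)
  have e4 : hf (I ⊔ Ideal.span {f}) (D + d) = Module.finrank F (LinearMap.range (φ.domRestrict M)) := by
    rw [hf, e1]
  have e5 : hf I (D + d) = Module.finrank F M := rfl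
  omega

lemma hf_lower {ι : Type*} [Fintype ι] (I : Ideal (MvPolynomial (Fin n) F)) (D : ℕ)
    (v : ι → MvPolynomial (Fin n) F) (hv : ∀ i, (v i).totalDegree ≤ D)
    (hI : ∀ c : ι → F, ∑ i, c i • v i ∈ I → ∀ i, c i = 0) : Fintype.card ι ≤ hf I D := by
  set M := ((restrictTotalDegree (Fin n) F D).map (Ideal.Quotient.mkₐ F I).toLinearMap) with hM
  let w : ι → M := fun i => ⟨Ideal.Quotient.mkₐ F I (v i), ⟨v i, by
    simp only [SetLike.mem_coe, mem_restrictTotalDegree]; exact hv i, rfl⟩⟩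
  have hw : LinearIndependent F w := by
    rw [Fintype.linearIndependent_iff]
    intro c hc
    apply hI c
    rw [← Ideal.Quotient.eq_zero_iff_mem]
    have := congrArg (fun z : M => (z : MvPolynomial (Fin n) F ⧸ I)) hc
    simp only [w, Submodule.coe_sum, Submodule.coe_smul, Submodule.coe_zero] at this
    rw [← this]
    show Ideal.Quotient.mkₐ F I _ = _
    simp only [map_sum, map_smul]
  exact hw.fintype_card_le_finrank

lemma hf_basis (I : Ideal (MvPolynomial (Fin n) F)) (D : ℕ) :
    ∃ v : Fin (hf I D) → MvPolynomial (Fin n) F, (∀ i, (v i).totalDegree ≤ D) ∧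
      ∀ c : Fin (hf I D) → F, ∑ i, c i • v i ∈ I → ∀ i, c i = 0 := by
  set M := ((restrictTotalDegree (Fin n) F D).map (Ideal.Quotient.mkₐ F I).toLinearMap) with hM
  let b : Module.Basis (Fin (hf I D)) F M := Module.finBasis F M
  have h : ∀ i, ∃ v : MvPolynomial (Fin n) F, v.totalDegree ≤ D ∧ Ideal.Quotient.mkₐ F I v = b i := by
    intro i
    obtain ⟨v, hv, hv2⟩ := (b i).2
    refine ⟨v, ?_, hv2⟩
    simpa only [SetLike.mem_coe, mem_restrictTotalDegree] using hv
  choose v hv hv2 using h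
  refine ⟨v, hv, fun c hc => ?_⟩
  have := Fintype.linearIndependent_iff.1 b.linearIndependent c
  apply this
  ext
  simp only [Submodule.coe_sum, Submodule.coe_smul, Submodule.coe_zero, ← hv2]
  rw [← Ideal.Quotient.eq_zero_iff_mem] at hc
  rw [← hc]
  show _ = Ideal.Quotient.mkₐ F I _
  simp only [map_sum, map_smul]

lemma hf_points [Fintype F] (I : Ideal (MvPolynomial (Fin n) F)) (Z : Finset (Fin n → F))
    (hZ : ∀ x ∈ Z, ∀ g ∈ I, eval x g = 0) : ∃ D0, ∀ D, D0 ≤ D → Z.card ≤ hf I D := by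
  classical
  refine ⟨Finset.univ.sup (fun z : Z => (MvPolynomial.indicator z.1).totalDegree), fun D hD => ?_⟩
  rw [← Fintype.card_coe]
  apply hf_lower I D (fun z : Z => MvPolynomial.indicator z.1)
  · intro z
    exact (Finset.le_sup (f := fun z : Z => (MvPolynomial.indicator z.1).totalDegree) (Finset.mem_univ z)).trans hD
  · intro c hc z
    have := hZ z.1 z.2 _ hc
    rw [map_sum, Finset.sum_eq_single z] at this
    · simpa [smul_eval, MvPolynomial.eval_indicator_apply_eq_one] using this
    · intro b _ hb
      rw [smul_eval, MvPolynomial.eval_indicator_apply_eq_zero _ _ (fun h => hb (Subtype.ext h.symm)), mul_zero]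
    · simp

lemma hf_indep (P : Ideal (MvPolynomial (Fin n) F)) (S : Finset (Fin n))
    (hS : ∀ g ∈ P, (∀ m ∈ g.support, ∀ i, m i ≠ 0 → i ∈ S) → g = 0) (t : ℕ) :
    (t + 1) ^ S.card ≤ hf P (n * t) := by
  classical
  have hc : (t + 1) ^ S.card = Fintype.card (S → Fin (t+1)) := by simp
  rw [hc]
  let mo : (S → Fin (t+1)) → (Fin n →₀ ℕ) := fun φ =>
    Finsupp.equivFunOnFinite.symm (fun i => if h : i ∈ S then (φ ⟨i, h⟩ : ℕ) else 0)
  have hmo : Function.Injective mo := by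
    intro φ ψ h
    ext i
    have := DFunLike.congr_fun h i.1
    simpa [mo] using this
  apply hf_lower P (n * t) (fun φ => monomial (mo φ) (1 : F))
  · intro φ
    refine (totalDegree_monomial_le _ _).trans ?_
    rw [Finsupp.sum_fintype _ _ (by simp)]
    calc ∑ i, mo φ i ≤ ∑ i : Fin n, t := by
          apply Finset.sum_le_sum
          intro i _
          simp only [mo, Finsupp.equivFunOnFinite_symm_apply_apply]
          split_ifs
          · omega
          · omega
      _ = n * t := by simp
  · intro c hc φ
    have hco : ∀ m, coeff m (∑ ψ, c ψ • monomial (mo ψ) (1 : F)) = ∑ ψ, if mo ψ = m then c ψ else 0 := by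
      intro m
      rw [coeff_sum]
      apply Finset.sum_congr rfl
      intro ψ _
      rw [coeff_smul, coeff_monomial]
      simp
    have h0 := hS _ hc (by
      intro m hm i hi
      rw [mem_support_iff, hco] at hm
      obtain ⟨ψ, _, hψ⟩ := Finset.exists_ne_zero_of_sum_ne_zero hm
      have : mo ψ = m := by by_contra hne; simp [hne] at hψ
      rw [← this] at hi
      by_contra hiS
      simp [mo, hiS] at hi)
    have := hco (mo φ)
    rw [h0, coeff_zero] at this
    rw [Finset.sum_eq_single φ] at this
    · simpa using this.symm
    · intro ψ _ hne
      rw [if_neg (fun h => hne (hmo h))]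
    · simp

lemma hf_primes {A : Type*} [Fintype A] (I : Ideal (MvPolynomial (Fin n) F))
    (P : A → Ideal (MvPolynomial (Fin n) F)) (hP : ∀ a, (P a).IsPrime) (hIP : ∀ a, I ≤ P a)
    (hinc : ∀ a b, P a ≤ P b → a = b) :
    ∃ e, ∀ D, ∑ a, hf (P a) D ≤ hf I (D + e) := by
  classical
  have hu : ∀ a, ∃ u, u ∉ P a ∧ ∀ b, b ≠ a → u ∈ P b := by
    intro a
    have : ¬ ((Finset.univ.erase a).inf P ≤ P a) := by
      rw [(hP a).inf_le']
      rintro ⟨b, hb, hba⟩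
      exact (Finset.mem_erase.1 hb).1 (hinc b a hba)
    obtain ⟨u, hu, hu2⟩ := SetLike.not_le_iff_exists.1 this
    refine ⟨u, hu2, fun b hb => ?_⟩
    have h3 : (Finset.univ.erase a).inf P ≤ P b := Finset.inf_le (by simp [hb])
    exact h3 hu
  choose u hu hu2 using hu
  refine ⟨Finset.univ.sup (fun a => (u a).totalDegree), fun D => ?_⟩
  choose v hv hv2 using fun a => hf_basis (P a) D
  have : ∑ a, hf (P a) D = Fintype.card (Σ a, Fin (hf (P a) D)) := by simp
  rw [this]
  apply hf_lower I _ (fun x : Σ a, Fin (hf (P a) D) => v x.1 x.2 * u x.1)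
  · rintro ⟨a, i⟩
    have h1 : (u a).totalDegree ≤ Finset.univ.sup (fun a => (u a).totalDegree) :=
      Finset.le_sup (f := fun a => (u a).totalDegree) (Finset.mem_univ a)
    have h2 := hv a i
    exact (totalDegree_mul _ _).trans (by dsimp only; omega)
  · rintro c hc ⟨a, i⟩
    apply hv2 a (fun i => c ⟨a, i⟩)
    have h1 := hIP a hc
    rw [← Finset.univ_sigma_univ, Finset.sum_sigma] at h1
    rw [← Finset.add_sum_erase _ _ (Finset.mem_univ a)] at h1
    have h2 : ∑ x ∈ Finset.univ.erase a, ∑ j, c ⟨x, j⟩ • (v x j * u x) ∈ P a := by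
      apply Ideal.sum_mem
      intro b hb
      apply Ideal.sum_mem
      intro j _
      rw [smul_eq_C_mul]
      exact Ideal.mul_mem_left _ _ (Ideal.mul_mem_left _ _ (hu2 b a (fun h => (Finset.mem_erase.1 hb).1 h.symm)))
    have h3 := (Ideal.add_mem_iff_left _ h2).1 h1
    have h4 : (∑ j, c ⟨a, j⟩ • v a j) * u a ∈ P a := by
      rw [Finset.sum_mul]
      simpa only [smul_mul_assoc] using h3
    exact ((hP a).mem_or_mem h4).resolve_right (hu a)
end

section
open MvPolynomial
def itS : ℕ → (ℕ → ℕ) → ℕ → ℕ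
  | 0, h => h
  | i + 1, h => itS i (fun J => ∑ j ∈ Finset.range (J + 1), h j)

lemma itS_mono (i : ℕ) : ∀ {h h' : ℕ → ℕ}, (∀ j, h j ≤ h' j) → ∀ J, itS i h J ≤ itS i h' J := by
  induction i with
  | zero => intro h h' H J; exact H J
  | succ i ih => intro h h' H J; exact ih (fun j => Finset.sum_le_sum fun a _ => H a) J

lemma itS_L1 (i : ℕ) : ∀ (h : ℕ → ℕ) (s j0 a : ℕ), (∀ j, s * (j + a).choose a ≤ h (j + j0)) →
    ∀ J, s * (J + a + i).choose (a + i) ≤ itS i h (J + j0) := by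
  induction i with
  | zero => intro h s j0 a H J; exact H J
  | succ i ih =>
    intro h s j0 a H J
    have := ih (fun J => ∑ j ∈ Finset.range (J + 1), h j) s j0 (a + 1) (by
      intro j
      have h1 := Nat.sum_range_add_choose j a
      rw [show j + (a + 1) = j + a + 1 by ring, ← h1, Finset.mul_sum]
      calc ∑ i ∈ Finset.range (j+1), s * (i + a).choose a ≤ ∑ i ∈ Finset.range (j+1), h (i + j0) :=
            Finset.sum_le_sum fun x _ => H x
        _ ≤ ∑ i ∈ Finset.range (j + j0 + 1), h i := by
            rw [show j + j0 + 1 = j0 + (j + 1) by ring, Finset.sum_range_add _ j0]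
            refine le_trans (le_of_eq ?_) (Nat.le_add_left _ _)
            exact Finset.sum_congr rfl fun x _ => by rw [add_comm]) J
    rw [show J + a + (i + 1) = J + (a + 1) + i by ring, show a + (i + 1) = a + 1 + i by ring]
    exact this

lemma itS_L2 (i : ℕ) : ∀ (h : ℕ → ℕ), Monotone h → ∀ J, J ^ i * h J ≤ itS i h (2 ^ i * J) := by
  induction i with
  | zero => intro h _ J; simp [itS]
  | succ i ih =>
    intro h hm J
    have h1 := ih (fun J => ∑ j ∈ Finset.range (J + 1), h j) (by
      intro a b hab
      exact Finset.sum_le_sum_of_subset (Finset.range_mono (by omega))) (2 * J)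
    rw [show 2 ^ (i + 1) * J = 2 ^ i * (2 * J) by ring]
    refine le_trans ?_ h1
    have h2 : J * h J ≤ ∑ j ∈ Finset.range (2 * J + 1), h j := by
      rw [show 2 * J + 1 = J + (J + 1) by ring, Finset.sum_range_add]
      calc J * h J ≤ ∑ x ∈ Finset.range (J + 1), h J := by simp; nlinarith
        _ ≤ ∑ x ∈ Finset.range (J + 1), h (J + x) := Finset.sum_le_sum fun x _ => hm (by omega)
        _ ≤ _ := Nat.le_add_left _ _
    calc J ^ (i + 1) * h J = J ^ i * (J * h J) := by ring
      _ ≤ (2 * J) ^ i * ∑ j ∈ Finset.range (2 * J + 1), h j := by gcongr; omega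

variable {F : Type*} [Field F] {n : ℕ}

def GoodS : (i : ℕ) → (Fin i → MvPolynomial (Fin n) F) → Prop
  | 0, _ => True
  | i + 1, g => GoodS i (Fin.tail g) ∧
      ∀ P ∈ (Ideal.span (Set.range (Fin.tail g))).minimalPrimes, g 0 ∉ P

lemma span_tail {i : ℕ} (g : Fin (i+1) → MvPolynomial (Fin n) F) :
    Ideal.span (Set.range g) = Ideal.span (Set.range (Fin.tail g)) ⊔ Ideal.span {g 0} := by
  rw [← Ideal.span_union]
  congr 1
  ext x
  simp only [Set.mem_range, Set.mem_union, Set.mem_singleton_iff, Fin.exists_fin_succ, Fin.tail]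
  tauto

lemma good_bound (d : ℕ) : ∀ (i : ℕ) (g : Fin i → MvPolynomial (Fin n) F) (_ : ∀ j, (g j).totalDegree ≤ d)
    (_ : GoodS i g) (J : ℕ),
    itS i (fun j => hf (Ideal.span (Set.range g)).radical (j * d)) J ≤ (J * d + n).choose n := by
  intro i
  induction i with
  | zero => intro g _ _ J; exact hf_le _ _
  | succ i ih =>
    intro g hg hG J
    refine le_trans ?_ (ih (Fin.tail g) (fun j => hg _) hG.1 J)
    refine itS_mono i (fun J => ?_) J
    set I := Ideal.span (Set.range (Fin.tail g)) with hI
    have key : ∀ j, hf (Ideal.span (Set.range g)).radical j ≤ hf (I.radical ⊔ Ideal.span {g 0}) j := by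
      intro j
      apply hf_anti
      rw [span_tail]
      refine sup_le (Ideal.radical_mono le_sup_left) (le_trans le_sup_right Ideal.le_radical)
    have nzd : ∀ x, g 0 * x ∈ I.radical → x ∈ I.radical := by
      intro x hx
      rw [← Ideal.sInf_minimalPrimes, Submodule.mem_sInf] at hx ⊢
      intro P hP
      exact (hP.isPrime.mem_or_mem (hx P hP)).resolve_left (hG.2 P hP)
    beta_reduce
    induction J with
    | zero =>
      simp only [zero_add, Finset.sum_range_one]
      exact (key _).trans (hf_anti le_sup_left _)
    | succ J ihJ =>
      rw [Finset.sum_range_succ]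
      have h1 := hf_step I.radical (g 0) d (hg 0) nzd (J * d)
      have h2 := key (J * d + d)
      rw [show (J + 1) * d = J * d + d by ring]
      omega

lemma good_minprimes (d : ℕ) (hd : 1 ≤ d) (hn : 1 ≤ n) (i : ℕ) (hin : i ≤ n)
    (g : Fin i → MvPolynomial (Fin n) F) (hg : ∀ j, (g j).totalDegree ≤ d)
    (hG : GoodS i g) :
    (Ideal.span (Set.range g)).minimalPrimes.ncard ≤ (2 ^ n * d * (n + 1) + n) ^ n := by
  classical
  set I := Ideal.span (Set.range g) with hI
  have hfin : I.minimalPrimes.Finite := Ideal.finite_minimalPrimes_of_isNoetherianRing _ I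
  have : Fintype I.minimalPrimes := hfin.fintype
  have hpr : ∀ a : I.minimalPrimes, (a.1).IsPrime := fun a => a.2.isPrime
  obtain ⟨e, he⟩ := hf_primes I.radical (fun a : I.minimalPrimes => a.1) hpr
    (fun a => by rw [← Ideal.sInf_minimalPrimes]; exact sInf_le a.2)
    (fun a b hab => Subtype.ext (le_antisymm hab (b.2.2 ⟨hpr a, a.2.1.2⟩ hab)))
  have hS : ∀ (a : I.minimalPrimes) (t : ℕ), (t + 1) ^ (n - i) ≤ hf a.1 (n * t) := by
    intro a t
    have := hpr a
    obtain ⟨S, hS1, hS2⟩ := indep_vars n a.1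
    refine le_trans ?_ (hf_indep a.1 S hS2 t)
    apply Nat.pow_le_pow_right (by omega)
    have h1 : a.1.height ≤ (Set.range g).ncard := Ideal.height_le_card_of_mem_minimalPrimes_span (Set.finite_range g) a.2
    have h2 : (Set.range g).ncard ≤ i := by
      rw [← Set.image_univ]
      refine (Set.ncard_image_le).trans (by simp)
    have h3 : (n : ℕ∞) ≤ ((S.card + i : ℕ) : ℕ∞) := by
      push_cast
      refine hS1.trans ?_
      gcongr
      exact h1.trans (by exact_mod_cast h2)
    have h4 : n ≤ S.card + i := by exact_mod_cast h3
    omega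
  set L := I.minimalPrimes.ncard with hL
  have hL' : L = Fintype.card I.minimalPrimes := by rw [hL, Set.ncard_eq_toFinset_card', Set.toFinset_card]
  set t := e + 1 with ht
  set J := n * t + e with hJ
  have h1 : L * (t + 1) ^ (n - i) ≤ hf I.radical (J * d) := by
    calc L * (t + 1) ^ (n - i) = ∑ a : I.minimalPrimes, (t + 1) ^ (n - i) := by simp [hL']
      _ ≤ ∑ a : I.minimalPrimes, hf a.1 (n * t) := Finset.sum_le_sum fun a _ => hS a t
      _ ≤ hf I.radical (n * t + e) := he _
      _ ≤ _ := hf_mono _ (by nlinarith)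
  have h2 := itS_L2 i (fun j => hf I.radical (j * d)) (fun a b hab => hf_mono _ (by gcongr)) J
  have h3 := good_bound d i g hg hG (2 ^ i * J)
  have h4 : (2 ^ i * J * d + n).choose n ≤ (2 ^ i * J * d + n) ^ n := Nat.choose_le_pow _ _
  have htJ : t ≤ J := by nlinarith
  have hJt : J ≤ (n + 1) * t := by nlinarith
  have h5 : L * t ^ n ≤ (2 ^ n * d * (n + 1) + n) ^ n * t ^ n := by
    calc L * t ^ n = t ^ i * (L * t ^ (n - i)) := by
          rw [show n = i + (n - i) by omega, pow_add]
          simp; ring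
      _ ≤ J ^ i * (L * (t + 1) ^ (n - i)) := by gcongr; omega
      _ ≤ J ^ i * hf I.radical (J * d) := by gcongr
      _ ≤ (2 ^ i * J * d + n) ^ n := by
          exact h2.trans (h3.trans h4)
      _ ≤ (2 ^ n * ((n + 1) * t) * d + n * t) ^ n := by
          gcongr
          · norm_num
          · nlinarith
      _ = _ := by rw [← mul_pow]; ring
  exact Nat.le_of_mul_le_mul_right h5 (by positivity)

lemma lim_aux (n d s D0 : ℕ) (h : ∀ x : ℕ, s * (x + 1) ^ n ≤ ((x + D0) * d + n) ^ n) : s ≤ d ^ n := by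
  have h1 : Filter.Tendsto (fun x : ℕ => ((d : ℝ) + ((D0 * d + n : ℕ) : ℝ) / ((x : ℝ) + 1)) ^ n) Filter.atTop (nhds (((d : ℝ) + 0) ^ n)) := by
    apply Filter.Tendsto.pow
    apply Filter.Tendsto.add tendsto_const_nhds
    exact (tendsto_const_div_atTop_nhds_zero_nat ((D0 * d + n : ℕ) : ℝ)).comp (Filter.tendsto_add_atTop_nat 1) |>.congr (by intro x; simp)
  have h2 : (s : ℝ) ≤ ((d : ℝ) + 0) ^ n := by
    apply ge_of_tendsto' h1
    intro x
    have hx : (0 : ℝ) < (x : ℝ) + 1 := by positivity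
    have h3 : (s : ℝ) * ((x : ℝ) + 1) ^ n ≤ (((x : ℝ) + D0) * d + n) ^ n := by exact_mod_cast h x
    rw [← le_div_iff₀ (by positivity), ← div_pow] at h3
    refine h3.trans ?_
    apply pow_le_pow_left₀ (by positivity)
    rw [div_le_iff₀ hx, add_mul (d : ℝ), div_mul_cancel₀ _ hx.ne']
    push_cast
    nlinarith [(Nat.cast_nonneg d : (0:ℝ) ≤ d)]
  rw [add_zero] at h2
  exact_mod_cast h2

lemma bezout [Fintype F] (d : ℕ) (hd : 1 ≤ d)
    (g : Fin n → MvPolynomial (Fin n) F) (hg : ∀ j, (g j).totalDegree ≤ d)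
    (hG : GoodS n g) (Z : Finset (Fin n → F)) (hZ : ∀ x ∈ Z, ∀ j, eval x (g j) = 0) : Z.card ≤ d ^ n := by
  set I := Ideal.span (Set.range g) with hI
  obtain ⟨D0, hD0⟩ := hf_points I.radical Z (by
    intro x hx p hp
    obtain ⟨m, hm⟩ := hp
    have h1 : I ≤ RingHom.ker (eval x) := by
      rw [hI, Ideal.span_le]
      rintro _ ⟨j, rfl⟩
      exact hZ x hx j
    have := h1 hm
    rw [RingHom.mem_ker, map_pow] at this
    exact eq_zero_of_pow_eq_zero this)
  apply lim_aux n d _ D0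
  intro x
  have h1 := itS_L1 n (fun j => hf I.radical (j * d)) Z.card D0 0 (by
    intro j
    simp only [add_zero, Nat.choose_zero_right, mul_one]
    exact hD0 _ (by nlinarith)) x
  have h2 := h1.trans (good_bound d n g hg hG (x + D0))
  simp only [add_zero, zero_add] at h2
  have h3 : (x + 1) ^ n ≤ n.factorial * (x + n).choose n := by
    rw [← Nat.ascFactorial_eq_factorial_mul_choose]
    exact Nat.pow_succ_le_ascFactorial _ _
  have h4 : n.factorial * ((x + D0) * d + n).choose n ≤ ((x + D0) * d + n) ^ n := by
    rw [← Nat.descFactorial_eq_factorial_mul_choose]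
    exact Nat.descFactorial_le_pow _ _
  calc Z.card * (x + 1) ^ n ≤ Z.card * (n.factorial * (x + n).choose n) := by gcongr
    _ = n.factorial * (Z.card * (x + n).choose n) := by ring
    _ ≤ n.factorial * ((x + D0) * d + n).choose n := by gcongr
    _ ≤ _ := h4
end

section
open MvPolynomial
lemma rtd_finite (F : Type*) [Field F] [Finite F] (n d : ℕ) : Finite (restrictTotalDegree (Fin n) F d) :=
  Module.finite_of_finite F

lemma count_P {F : Type*} [Field F] [Fintype F] {n : ℕ} (d : ℕ) (P : Ideal (MvPolynomial (Fin n) F)) (S : Finset (Fin n))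
    (hS : ∀ g ∈ P, (∀ m ∈ g.support, ∀ i, m i ≠ 0 → i ∈ S) → g = 0) (hne : S.Nonempty) :
    Nat.card {v : restrictTotalDegree (Fin n) F d // v.1 ∈ P} * Fintype.card F ^ (d + 1) ≤
      Nat.card (restrictTotalDegree (Fin n) F d) := by
  classical
  have := rtd_finite F n d
  obtain ⟨i, hi⟩ := hne
  have h1 : Fintype.card F ^ (d + 1) = Nat.card (Fin (d + 1) → F) := by simp
  rw [h1, ← Nat.card_prod]
  let w : (Fin (d+1) → F) → MvPolynomial (Fin n) F := fun c => ∑ j : Fin (d+1), monomial (Finsupp.single i (j : ℕ)) (c j)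
  have hw : ∀ c, w c ∈ restrictTotalDegree (Fin n) F d := by
    intro c
    apply Submodule.sum_mem
    intro j _
    rw [mem_restrictTotalDegree]
    refine (totalDegree_monomial_le _ _).trans ?_
    rw [Finsupp.sum_single_index rfl]
    show (j : ℕ) ≤ d
    omega
  have hw0 : ∀ c c', w c - w c' ∈ P → c = c' := by
    intro c c' h
    have h2 : w c - w c' = ∑ j : Fin (d+1), monomial (Finsupp.single i (j : ℕ)) (c j - c' j) := by
      simp only [w, ← Finset.sum_sub_distrib, map_sub]
    have h3 := hS _ h (by
      intro m hm l hl
      rw [h2, mem_support_iff, coeff_sum] at hm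
      obtain ⟨j, _, hj⟩ := Finset.exists_ne_zero_of_sum_ne_zero hm
      rw [coeff_monomial] at hj
      have hm2 : Finsupp.single i (j : ℕ) = m := by by_contra hne; simp [hne] at hj
      rw [← hm2, Finsupp.single_apply] at hl
      have : i = l := by by_contra hne; simp [hne] at hl
      exact this ▸ hi)
    ext j
    have h4 := congrArg (coeff (Finsupp.single i (j : ℕ))) h3
    rw [h2, coeff_sum, coeff_zero, Finset.sum_eq_single j] at h4
    · rw [coeff_monomial, if_pos rfl] at h4
      exact sub_eq_zero.1 h4
    · intro b _ hb
      rw [coeff_monomial, if_neg]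
      intro he
      have := DFunLike.congr_fun he i
      simp only [Finsupp.single_eq_same] at this
      exact hb (Fin.ext this)
    · simp
  apply Nat.card_le_card_of_injective (fun x : {v : restrictTotalDegree (Fin n) F d // v.1 ∈ P} × (Fin (d + 1) → F) =>
    x.1.1 + (⟨w x.2, hw x.2⟩ : restrictTotalDegree (Fin n) F d))
  rintro ⟨⟨v, hv⟩, c⟩ ⟨⟨v', hv'⟩, c'⟩ h
  have h5 : v.1 + w c = v'.1 + w c' := congrArg (fun z : restrictTotalDegree (Fin n) F d => z.1) h
  have hcc : c = c' := by
    apply hw0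
    have : w c - w c' = v'.1 - v.1 := by linear_combination h5
    rw [this]
    exact P.sub_mem hv' hv
  subst hcc
  have : v = v' := Subtype.ext (add_right_cancel h5)
  subst this
  rfl

lemma count_step {F : Type*} [Field F] [Fintype F] {n : ℕ} (d : ℕ) (hd : 1 ≤ d) (hn : 1 ≤ n) (i : ℕ) (hin : i < n)
    (g : Fin i → MvPolynomial (Fin n) F) (hg : ∀ j, (g j).totalDegree ≤ d)
    (hG : GoodS i g) :
    Nat.card {v : restrictTotalDegree (Fin n) F d // ∃ P ∈ (Ideal.span (Set.range g)).minimalPrimes, v.1 ∈ P} * Fintype.card F ^ (d + 1) ≤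
      (2 ^ n * d * (n + 1) + n) ^ n * Nat.card (restrictTotalDegree (Fin n) F d) := by
  classical
  have := rtd_finite F n d
  have := Fintype.ofFinite (restrictTotalDegree (Fin n) F d)
  have hmp := good_minprimes d hd hn i hin.le g hg hG
  set I := Ideal.span (Set.range g) with hI
  have hfin : I.minimalPrimes.Finite := Ideal.finite_minimalPrimes_of_isNoetherianRing _ I
  rw [Set.ncard_eq_toFinset_card _ hfin] at hmp
  have h1 : Nat.card {v : restrictTotalDegree (Fin n) F d // ∃ P ∈ I.minimalPrimes, v.1 ∈ P} ≤
      ∑ P ∈ hfin.toFinset, Nat.card {v : restrictTotalDegree (Fin n) F d // v.1 ∈ P} := by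
    simp only [Nat.card_eq_fintype_card, Fintype.card_subtype]
    refine le_trans (Finset.card_le_card ?_) Finset.card_biUnion_le
    intro v hv
    simp only [Finset.mem_filter, Finset.mem_univ, true_and, Finset.mem_biUnion, Set.Finite.mem_toFinset] at hv ⊢
    exact hv
  calc _ ≤ (∑ P ∈ hfin.toFinset, Nat.card {v : restrictTotalDegree (Fin n) F d // v.1 ∈ P}) * Fintype.card F ^ (d + 1) := by gcongr
    _ = ∑ P ∈ hfin.toFinset, Nat.card {v : restrictTotalDegree (Fin n) F d // v.1 ∈ P} * Fintype.card F ^ (d + 1) := Finset.sum_mul _ _ _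
    _ ≤ ∑ P ∈ hfin.toFinset, Nat.card (restrictTotalDegree (Fin n) F d) := by
        apply Finset.sum_le_sum
        intro P hP
        rw [Set.Finite.mem_toFinset] at hP
        have hpr : P.IsPrime := hP.isPrime
        obtain ⟨S, hS1, hS2⟩ := indep_vars n P
        apply count_P d P S hS2
        rw [Finset.nonempty_iff_ne_empty]
        rintro rfl
        have h1 : P.height ≤ (Set.range g).ncard := Ideal.height_le_card_of_mem_minimalPrimes_span (Set.finite_range g) hP
        have h2 : (Set.range g).ncard ≤ i := by
          rw [← Set.image_univ]
          refine (Set.ncard_image_le).trans (by simp)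
        simp only [Finset.card_empty, Nat.cast_zero, zero_add] at hS1
        have h3 : n ≤ (Set.range g).ncard := by exact_mod_cast hS1.trans h1
        omega
    _ = hfin.toFinset.card * Nat.card (restrictTotalDegree (Fin n) F d) := by simp
    _ ≤ _ := by gcongr

lemma count_bad {F : Type*} [Field F] [Fintype F] {n : ℕ} (d : ℕ) (hd : 1 ≤ d) (hn : 1 ≤ n) (i : ℕ) (hin : i ≤ n) :
    Nat.card {g : Fin i → restrictTotalDegree (Fin n) F d // ¬ GoodS i (fun j => (g j).1)} * Fintype.card F ^ (d + 1) ≤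
      i * (2 ^ n * d * (n + 1) + n) ^ n * Nat.card (restrictTotalDegree (Fin n) F d) ^ i := by
  classical
  have := rtd_finite F n d
  have := Fintype.ofFinite (restrictTotalDegree (Fin n) F d)
  set V := restrictTotalDegree (Fin n) F d with hV
  set K := (2 ^ n * d * (n + 1) + n) ^ n with hK
  induction i with
  | zero => simp [GoodS]
  | succ i ih =>
    have ih := ih (by omega)
    set B := Nat.card {g : Fin i → V // ¬ GoodS i (fun j => (g j).1)} with hB
    have h1 : Nat.card {g : Fin (i+1) → V // ¬ GoodS (i+1) (fun j => (g j).1)} ≤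
        B * Nat.card V + ∑ h : Fin i → V, if GoodS i (fun j => (h j).1) then
          Nat.card {v : V // ∃ P ∈ (Ideal.span (Set.range (fun j => (h j).1))).minimalPrimes, v.1 ∈ P} else 0 := by
      have e1 : B * Nat.card V = ∑ h : Fin i → V, if GoodS i (fun j => (h j).1) then 0 else Nat.card V := by
        rw [hB, Nat.card_eq_fintype_card, Fintype.card_subtype, Finset.card_filter, Finset.sum_mul]
        apply Finset.sum_congr rfl
        intro h _
        split_ifs <;> simp_all
      rw [e1, ← Finset.sum_add_distrib, Nat.card_eq_fintype_card, Fintype.card_subtype]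
      have e2 : (Finset.univ.filter fun g : Fin (i+1) → V => ¬ GoodS (i+1) (fun j => (g j).1)).card =
        ∑ h : Fin i → V, ((Finset.univ.filter fun g : Fin (i+1) → V => ¬ GoodS (i+1) (fun j => (g j).1)).filter
          fun g => Fin.tail g = h).card := by
        rw [Finset.card_eq_sum_card_fiberwise (f := fun g : Fin (i+1) → V => (Fin.tail g : Fin i → V)) (t := Finset.univ)]
        intro x _; simp
      rw [e2]
      apply Finset.sum_le_sum
      intro h _
      split_ifs with hg
      · rw [zero_add, Nat.card_eq_fintype_card, Fintype.card_subtype]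
        apply Finset.card_le_card_of_injOn (fun g => g 0)
        · intro g hg'
          simp only [Finset.coe_filter, Finset.mem_filter, Finset.mem_univ, true_and, Set.mem_ofPred_eq] at hg' ⊢
          obtain ⟨hg1, rfl⟩ := hg'
          by_contra hcon
          push Not at hcon
          exact hg1 ⟨hg, hcon⟩
        · intro g hg1 g' hg2 h0
          simp only [Finset.coe_filter, Finset.mem_filter, Finset.mem_univ, true_and, Set.mem_ofPred_eq] at hg1 hg2
          rw [← Fin.cons_self_tail g, ← Fin.cons_self_tail g', hg1.2, hg2.2]
          simp only at h0
          rw [h0]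
      · rw [add_zero, Nat.card_eq_fintype_card, ← Finset.card_univ]
        apply Finset.card_le_card_of_injOn (fun g => g 0)
        · intro g hg'
          simp
        · intro g hg1 g' hg2 h0
          simp only [Finset.coe_filter, Finset.mem_filter, Finset.mem_univ, true_and, Set.mem_ofPred_eq] at hg1 hg2
          rw [← Fin.cons_self_tail g, ← Fin.cons_self_tail g', hg1.2, hg2.2]
          simp only at h0
          rw [h0]
    have h2 : (∑ h : Fin i → V, if GoodS i (fun j => (h j).1) then
          Nat.card {v : V // ∃ P ∈ (Ideal.span (Set.range (fun j => (h j).1))).minimalPrimes, v.1 ∈ P} else 0) * Fintype.card F ^ (d+1)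
          ≤ K * Nat.card V ^ (i + 1) := by
      rw [Finset.sum_mul]
      calc _ ≤ ∑ h : Fin i → V, K * Nat.card V := by
            apply Finset.sum_le_sum
            intro h _
            split_ifs with hg
            · exact count_step d hd hn i (by omega) _ (fun j => (mem_restrictTotalDegree _ _ _).1 (h j).2) hg
            · simp
        _ = K * Nat.card V ^ (i + 1) := by
            simp [Nat.card_eq_fintype_card]; ring
    generalize (∑ h : Fin i → V, if GoodS i (fun j => (h j).1) then
          Nat.card {v : V // ∃ P ∈ (Ideal.span (Set.range (fun j => (h j).1))).minimalPrimes, v.1 ∈ P} else 0) = Y at h1 h2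
    have h3 := Nat.mul_le_mul_right (Fintype.card F ^ (d+1)) h1
    have h4 := Nat.mul_le_mul_left (Nat.card V) ih
    refine h3.trans ?_
    calc (B * Nat.card V + Y) * Fintype.card F ^ (d+1) = Nat.card V * (B * Fintype.card F ^ (d+1)) + Y * Fintype.card F ^ (d+1) := by ring
      _ ≤ Nat.card V * (i * K * Nat.card V ^ i) + K * Nat.card V ^ (i + 1) := add_le_add h4 h2
      _ = _ := by ring

lemma lemmaB (n d : ℕ) (hd : 1 ≤ d) (hn : 1 ≤ n) : ∃ C : ℕ, ∀ (F : Type) [Field F] [Fintype F],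
    Nat.card {g : Fin n → restrictTotalDegree (Fin n) F d //
      d ^ n < Nat.card {x : Fin n → F // ∀ i, eval x (g i).1 = 0}} * Fintype.card F ^ (d + 1) ≤
      C * Nat.card (restrictTotalDegree (Fin n) F d) ^ n := by
  classical
  refine ⟨n * (2 ^ n * d * (n + 1) + n) ^ n, fun F _ _ => ?_⟩
  have := rtd_finite F n d
  refine le_trans (Nat.mul_le_mul_right _ ?_) (count_bad d hd hn n le_rfl)
  have key : ∀ g : Fin n → restrictTotalDegree (Fin n) F d,
      d ^ n < Nat.card {x : Fin n → F // ∀ i, eval x (g i).1 = 0} → ¬ GoodS n (fun j => (g j).1) := by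
    intro g hg hG
    have h2 := bezout d hd (fun j => (g j).1) (fun j => (mem_restrictTotalDegree _ _ _).1 (g j).2) hG
      (Finset.univ.filter fun x => ∀ i, eval x (g i).1 = 0) (by simp)
    rw [← Fintype.card_subtype, ← Nat.card_eq_fintype_card] at h2
    omega
  let φ : {g : Fin n → restrictTotalDegree (Fin n) F d // d ^ n < Nat.card {x : Fin n → F // ∀ i, eval x (g i).1 = 0}} →
    {g : Fin n → restrictTotalDegree (Fin n) F d // ¬ GoodS n (fun j => (g j).1)} := fun g => ⟨g.1, key g.1 g.2⟩
  have hφ : Function.Injective φ := fun a b h => Subtype.ext (Subtype.mk.inj h)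
  exact Nat.card_le_card_of_injective φ hφ
end

section
open MvPolynomial
lemma sepPoly {F : Type*} [Field F] {n : ℕ} (Z : Finset (Fin n → F)) (y : Fin n → F) (hy : y ∉ Z) :
    ∃ p : MvPolynomial (Fin n) F, p.totalDegree ≤ Z.card ∧ eval y p ≠ 0 ∧ ∀ z ∈ Z, eval z p = 0 := by
  classical
  induction Z using Finset.induction_on with
  | empty => exact ⟨1, by simp, by simp, by simp⟩
  | insert z Z hz ih =>
    simp only [Finset.mem_insert, not_or] at hy
    obtain ⟨p, hp1, hp2, hp3⟩ := ih hy.2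
    obtain ⟨i, hi⟩ := Function.ne_iff.1 hy.1
    refine ⟨(X i - C (z i)) * p, ?_, ?_, ?_⟩
    · rw [Finset.card_insert_of_notMem hz]
      refine (totalDegree_mul _ _).trans ?_
      have := totalDegree_sub_C_le (X i : MvPolynomial (Fin n) F) (z i)
      rw [totalDegree_X] at this
      omega
    · simp only [map_mul, map_sub, eval_X, eval_C]
      exact mul_ne_zero (sub_ne_zero.2 hi) hp2
    · intro w hw
      rcases Finset.mem_insert.1 hw with rfl | hw
      · simp
      · simp [hp3 w hw]

lemma rel_card {F : Type*} [Field F] {n : ℕ} {W : Type*} [AddCommGroup W] [Module F W] (d : ℕ)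
    (Y : Finset (Fin n → F)) (c : (Fin n → F) → W) (hc : ∀ y ∈ Y, c y ≠ 0)
    (hR : ∀ p : MvPolynomial (Fin n) F, p.totalDegree ≤ d → ∑ y ∈ Y, eval y p • c y = 0)
    (hne : Y.Nonempty) : d + 2 ≤ Y.card := by
  classical
  by_contra hcon
  obtain ⟨y, hy⟩ := hne
  obtain ⟨p, hp1, hp2, hp3⟩ := sepPoly (Y.erase y) y (by simp)
  have hcard := Finset.card_erase_of_mem hy
  have h := hR p (by omega)
  rw [Finset.sum_eq_single_of_mem y hy] at h
  · exact (smul_ne_zero hp2 (hc y hy)) h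
  · intro b hb hby
    rw [hp3 b (Finset.mem_erase.2 ⟨hby, hb⟩), zero_smul]

lemma sepLine {F : Type*} [Field F] {n : ℕ} (a b y : Fin n → F) (hab : a ≠ b)
    (hy : ¬ ∃ t : F, y = a + t • (b - a)) :
    ∃ p : MvPolynomial (Fin n) F, p.totalDegree ≤ 1 ∧ eval y p ≠ 0 ∧ ∀ t : F, eval (a + t • (b - a)) p = 0 := by
  obtain ⟨i, hi⟩ := Function.ne_iff.1 hab
  have hi' : b i - a i ≠ 0 := sub_ne_zero.2 (Ne.symm hi)
  push Not at hy
  obtain ⟨j, hj⟩ := Function.ne_iff.1 (hy ((y i - a i) / (b i - a i)))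
  refine ⟨C (b i - a i) * (X j - C (a j)) - C (b j - a j) * (X i - C (a i)), ?_, ?_, ?_⟩
  · refine (totalDegree_sub _ _).trans (max_le ?_ ?_)
    · refine (totalDegree_mul _ _).trans ?_
      have := totalDegree_sub_C_le (X j : MvPolynomial (Fin n) F) (a j)
      rw [totalDegree_X] at this
      rw [totalDegree_C]; omega
    · refine (totalDegree_mul _ _).trans ?_
      have := totalDegree_sub_C_le (X i : MvPolynomial (Fin n) F) (a i)
      rw [totalDegree_X] at this
      rw [totalDegree_C]; omega
  · simp only [map_sub, map_mul, eval_C, eval_X]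
    intro h
    apply hj
    simp only [Pi.add_apply, Pi.smul_apply, Pi.sub_apply, smul_eq_mul]
    field_simp
    linear_combination h
  · intro t
    simp only [map_sub, map_mul, eval_C, eval_X, Pi.add_apply, Pi.smul_apply, Pi.sub_apply, smul_eq_mul]
    ring

lemma rel_mul {F : Type*} [Field F] [DecidableEq F] {n : ℕ} {W : Type*} [AddCommGroup W] [Module F W] (d : ℕ)
    (Y : Finset (Fin n → F)) (c : (Fin n → F) → W) (hc : ∀ y ∈ Y, c y ≠ 0)
    (hR : ∀ p : MvPolynomial (Fin n) F, p.totalDegree ≤ d + 1 → ∑ y ∈ Y, eval y p • c y = 0)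
    (l : MvPolynomial (Fin n) F) (hl : l.totalDegree ≤ 1) :
    (∀ y ∈ Y.filter (fun y => eval y l ≠ 0), eval y l • c y ≠ 0) ∧
    (∀ p : MvPolynomial (Fin n) F, p.totalDegree ≤ d → ∑ y ∈ Y.filter (fun y => eval y l ≠ 0), eval y p • (eval y l • c y) = 0) := by
  constructor
  · intro y hy
    rw [Finset.mem_filter] at hy
    exact smul_ne_zero hy.2 (hc y hy.1)
  · intro p hp
    rw [← hR (p * l) ((totalDegree_mul _ _).trans (by omega)), Finset.sum_filter]
    apply Finset.sum_congr rfl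
    intro y _
    rw [map_mul, mul_smul]
    split_ifs with h
    · rfl
    · push Not at h
      simp [h]

lemma rel_col {F : Type*} [Field F] {n : ℕ} {W : Type*} [AddCommGroup W] [Module F W] (d : ℕ) :
    ∀ (Y : Finset (Fin n → F)) (c : (Fin n → F) → W) (_ : ∀ y ∈ Y, c y ≠ 0)
    (_ : ∀ p : MvPolynomial (Fin n) F, p.totalDegree ≤ d → ∑ y ∈ Y, eval y p • c y = 0)
    (_ : Y.card ≤ 2 * d + 1), ∀ a ∈ Y, ∀ b ∈ Y, a ≠ b → ∀ y ∈ Y, ∃ t : F, y = a + t • (b - a) := by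
  classical
  induction d with
  | zero =>
    intro Y c _ _ hY a ha b hb hab
    exact absurd (Finset.card_le_one.1 (by omega) a ha b hb) hab
  | succ d ih =>
    intro Y c hc hR hY a ha b hb hab y hy
    by_contra hcon
    obtain ⟨l, hl1, hl2, hl3⟩ := sepLine a b y hab hcon
    obtain ⟨m1, m2⟩ := rel_mul d Y c hc hR l hl1
    have hla : eval a l = 0 := by simpa using hl3 0
    have hlb : eval b l = 0 := by simpa using hl3 1
    set Y' := Y.filter (fun y => eval y l ≠ 0) with hY'
    have hY'c : d + 2 ≤ Y'.card := rel_card d Y' _ m1 m2 ⟨y, by simp [hY', hy, hl2]⟩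
    have hsub : Y' ⊆ (Y.erase a).erase b := by
      intro z hz
      rw [hY', Finset.mem_filter] at hz
      simp only [Finset.mem_erase]
      refine ⟨?_, ?_, hz.1⟩
      · rintro rfl; exact hz.2 hlb
      · rintro rfl; exact hz.2 hla
    have h2 := Finset.card_le_card hsub
    rw [Finset.card_erase_of_mem (Finset.mem_erase.2 ⟨hab.symm, hb⟩), Finset.card_erase_of_mem ha] at h2
    have hcol := ih Y' _ m1 m2 (by omega)
    obtain ⟨a', ha', b', hb', hab'⟩ := Finset.one_lt_card.1 (show 1 < Y'.card by omega)
    have hcol' := hcol a' ha' b' hb' hab'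
    have : ∃ z ∈ Y, ¬ ∃ t : F, z = a' + t • (b' - a') := by
      by_contra hall
      push Not at hall
      obtain ⟨s, hs⟩ := hall a ha
      obtain ⟨t, ht⟩ := hall b hb
      obtain ⟨r, hr⟩ := hall y hy
      apply hcon
      have hst : t - s ≠ 0 := by
        intro h
        apply hab
        rw [hs, ht, sub_eq_zero.1 h]
      refine ⟨(r - s) / (t - s), ?_⟩
      rw [hr, hs, ht]
      ext i
      simp only [Pi.add_apply, Pi.smul_apply, Pi.sub_apply, smul_eq_mul]
      field_simp
      ring
    obtain ⟨z, hz, hz2⟩ := this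
    obtain ⟨l', hl1', hl2', hl3'⟩ := sepLine a' b' z hab' hz2
    obtain ⟨m1', m2'⟩ := rel_mul d Y c hc hR l' hl1'
    have hY''c := rel_card d _ _ m1' m2' ⟨z, by simp [hz, hl2']⟩
    have hdisj : Disjoint Y' (Y.filter (fun y => eval y l' ≠ 0)) := by
      rw [Finset.disjoint_left]
      intro w hw hw2
      rw [Finset.mem_filter] at hw2
      obtain ⟨t, ht⟩ := hcol' w hw
      exact hw2.2 (ht ▸ hl3' t)
    have h3 := Finset.card_le_card (Finset.union_subset (Finset.filter_subset _ _) (Finset.filter_subset _ _) :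
      Y' ∪ (Y.filter (fun y => eval y l' ≠ 0)) ⊆ Y)
    rw [Finset.card_union_of_disjoint hdisj] at h3
    omega
end

section
open MvPolynomial
def RelA (F : Type*) [Field F] (n k s d : ℕ) (w : (Fin s → Fin n → F) × (Fin s → Fin k → F)) : Prop :=
  (∀ j, w.2 j ≠ 0) ∧ ∀ p : MvPolynomial (Fin n) F, p.totalDegree ≤ d → ∑ j, eval (w.1 j) p • w.2 j = 0

def CaseA (F : Type*) [Field F] (n k s : ℕ) (φ : Fin s → Fin s) (w : (Fin s → Fin n → F) × (Fin s → Fin k → F)) : Prop :=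
  (∀ j, φ (φ j) = φ j) ∧ (∀ j, w.1 (φ j) = w.1 j) ∧ (∀ j, w.2 j ≠ 0) ∧
    (∀ j, ∑ l ∈ Finset.univ.filter (fun l => φ l = φ j), w.2 l = 0)

def CaseB (F : Type*) [Field F] (n k s d : ℕ) (σ : Fin (d + 2) → Fin s) (w : (Fin s → Fin n → F) × (Fin s → Fin k → F)) : Prop :=
  RelA F n k s d w ∧ Function.Injective (fun i => w.1 (σ i)) ∧
    ∃ t : Fin d → F, ∀ i : Fin d, w.1 (σ i.succ.succ) = w.1 (σ 0) + t i • (w.1 (σ 1) - w.1 (σ 0))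

lemma relA_cases {F : Type*} [Field F] (n k s d : ℕ) (hs : s ≤ 2 * d + 1)
    (w : (Fin s → Fin n → F) × (Fin s → Fin k → F)) (hw : RelA F n k s d w) :
    (∃ φ, CaseA F n k s φ w) ∨ (∃ σ, CaseB F n k s d σ w) := by
  classical
  obtain ⟨x, a⟩ := w
  obtain ⟨ha, hR⟩ := hw
  simp only at ha hR
  let c : (Fin n → F) → (Fin k → F) := fun y => ∑ l ∈ Finset.univ.filter (fun l => x l = y), a l
  by_cases h0 : ∀ j, c (x j) = 0
  · left
    have : ∀ j : Fin s, ∃ l, x l = x j := fun j => ⟨j, rfl⟩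
    let r : (Fin n → F) → Fin s → Fin s := fun y j0 => if h : ∃ l, x l = y then h.choose else j0
    have hr : ∀ j j0, x (r (x j) j0) = x j := by
      intro j j0
      have h : ∃ l, x l = x j := ⟨j, rfl⟩
      simp only [r, dif_pos h]
      exact h.choose_spec
    have hr2 : ∀ j j0 j1, r (x j) j0 = r (x j) j1 := by
      intro j j0 j1
      have h : ∃ l, x l = x j := ⟨j, rfl⟩
      simp only [r, dif_pos h]
    refine ⟨fun j => r (x j) j, ?_, ?_, ha, ?_⟩
    · intro j
      simp only
      rw [hr]; exact hr2 _ _ _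
    · intro j
      exact hr j j
    · intro j
      rw [← h0 j]
      apply Finset.sum_congr _ (fun _ _ => rfl)
      ext l
      simp only [Finset.mem_filter, Finset.mem_univ, true_and]
      constructor
      · intro h
        rw [← hr l l, h, hr]
      · intro h
        rw [h]; exact hr2 _ _ _
  · right
    push Not at h0
    obtain ⟨j0, hj0⟩ := h0
    let Y := (Finset.univ.image x).filter (fun y => c y ≠ 0)
    have hYc : ∀ y ∈ Y, c y ≠ 0 := fun y hy => (Finset.mem_filter.1 hy).2
    have hYR : ∀ p : MvPolynomial (Fin n) F, p.totalDegree ≤ d → ∑ y ∈ Y, eval y p • c y = 0 := by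
      intro p hp
      rw [← hR p hp, Finset.sum_filter_of_ne]
      · rw [← Finset.sum_fiberwise_of_maps_to (s := Finset.univ) (t := Finset.univ.image x) (g := x) (by simp)]
        apply Finset.sum_congr rfl
        intro y _
        simp only [c]
        rw [Finset.smul_sum]
        apply Finset.sum_congr rfl
        intro j hj
        rw [(Finset.mem_filter.1 hj).2]
      · intro y _ h hc
        rw [hc, smul_zero] at h
        exact h rfl
    have hYn : d + 2 ≤ Y.card := rel_card d Y c hYc hYR ⟨x j0, by simp [Y, hj0]⟩
    have hYs : Y.card ≤ s := by
      refine (Finset.card_filter_le _ _).trans (Finset.card_image_le.trans (by simp))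
    have hcol := rel_col d Y c hYc hYR (by omega)
    obtain ⟨e⟩ : Nonempty (Fin (d+2) ↪ Y) := by
      rw [Function.Embedding.nonempty_iff_card_le]; simpa using hYn
    have he : ∀ i, ∃ j, x j = (e i).1 := by
      intro i
      have := (Finset.mem_filter.1 (e i).2).1
      simpa using this
    choose σ hσ using he
    have hinj : Function.Injective (fun i => x (σ i)) := by
      intro i i' h
      simp only [hσ] at h
      exact e.injective (Subtype.ext h)
    refine ⟨σ, ⟨ha, hR⟩, hinj, ?_⟩
    have := fun i : Fin d => hcol (x (σ 0)) (hσ 0 ▸ (e 0).2) (x (σ 1)) (hσ 1 ▸ (e 1).2)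
      (fun h => by have := hinj h; simp at this) (x (σ i.succ.succ)) (hσ _ ▸ (e _).2)
    choose t ht using this
    exact ⟨t, ht⟩

lemma caseA_count {F : Type*} [Field F] [Fintype F] (k m : ℕ) (φ : Fin (2*m) → Fin (2*m)) :
    Nat.card {w // CaseA F (k+1) k (2*m) φ w} ≤ Fintype.card F ^ (k * (2*m) + m) := by
  classical
  rcases isEmpty_or_nonempty {w // CaseA F (k+1) k (2*m) φ w} with hE | ⟨⟨w0, h0⟩⟩
  · simp
  set I := Finset.univ.image φ with hI
  have hIφ : ∀ i ∈ I, φ i = i := by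
    intro i hi
    obtain ⟨j, _, rfl⟩ := Finset.mem_image.1 hi
    exact h0.1 j
  have hcardI : 2 * I.card ≤ 2 * m := by
    have h1 : (Finset.univ : Finset (Fin (2*m))).card = ∑ i ∈ I, (Finset.univ.filter (fun l => φ l = i)).card :=
      Finset.card_eq_sum_card_fiberwise (by intro x _; simp [hI])
    have h2 : ∑ i ∈ I, 2 ≤ ∑ i ∈ I, (Finset.univ.filter (fun l => φ l = i)).card := by
      apply Finset.sum_le_sum
      intro i hi
      by_contra hcon
      have hmem : i ∈ Finset.univ.filter (fun l => φ l = i) := by simp [hIφ i hi]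
      have h3 : Finset.univ.filter (fun l => φ l = i) = {i} := by
        apply Finset.eq_singleton_iff_unique_mem.2 ⟨hmem, fun l hl => ?_⟩
        exact Finset.card_le_one.1 (by omega) l hl i hmem
      have h4 := h0.2.2.2 i
      rw [hIφ i hi, h3, Finset.sum_singleton] at h4
      exact h0.2.2.1 i h4
    rw [← h1] at h2
    simp at h2
    omega
  have hinj : Function.Injective (fun w : {w // CaseA F (k+1) k (2*m) φ w} =>
      ((fun i : {i // i ∈ I} => w.1.1 i.1, fun i : {i // i ∉ I} => w.1.2 i.1) :
        ({i // i ∈ I} → Fin (k+1) → F) × ({i // i ∉ I} → Fin k → F))) := by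
    rintro ⟨⟨x, a⟩, h⟩ ⟨⟨x', a'⟩, h'⟩ heq
    simp only [Prod.mk.injEq] at heq
    obtain ⟨e1, e2⟩ := heq
    have hx : x = x' := by
      funext j
      have := congrFun e1 ⟨φ j, by simp [hI]⟩
      simp only at this
      exact ((h.2.1 j).symm.trans this).trans (h'.2.1 j)
    have ha1 : ∀ j, j ∉ I → a j = a' j := fun j hj => congrFun e2 ⟨j, hj⟩
    have ha : a = a' := by
      funext i
      by_cases hi : i ∈ I
      · have s1 := h.2.2.2 i
        have s2 := h'.2.2.2 i
        simp only at s1 s2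
        have hmem : i ∈ Finset.univ.filter (fun l => φ l = φ i) := by simp
        rw [← Finset.add_sum_erase _ _ hmem] at s1 s2
        have : ∑ l ∈ (Finset.univ.filter (fun l => φ l = φ i)).erase i, a l =
          ∑ l ∈ (Finset.univ.filter (fun l => φ l = φ i)).erase i, a' l := by
          apply Finset.sum_congr rfl
          intro l hl
          simp only [Finset.mem_erase, Finset.mem_filter, Finset.mem_univ, true_and] at hl
          apply ha1
          intro hlI
          rw [hIφ l hlI, hIφ i hi] at hl
          exact hl.1 hl.2
        rw [this, ← s2] at s1
        exact add_right_cancel s1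
      · exact ha1 i hi
    subst hx; subst ha; rfl
  refine (Nat.card_le_card_of_injective _ hinj).trans ?_
  rw [Nat.card_prod]
  simp only [Nat.card_eq_fintype_card, Fintype.card_fun, Fintype.card_fin, Fintype.card_subtype_compl, Fintype.card_coe]
  rw [← pow_mul, ← pow_mul, ← pow_add]
  apply Nat.pow_le_pow_right Fintype.card_pos
  have : I.card ≤ m := by omega
  obtain ⟨r, hr⟩ := Nat.exists_eq_add_of_le this
  have e : 2 * m - I.card = I.card + 2 * r := by omega
  rw [e]
  generalize I.card = v at *
  subst hr
  nlinarith

lemma caseB_count {F : Type*} [Field F] [Fintype F] (k s d : ℕ) (σ : Fin (d+2) → Fin s) :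
    Nat.card {w // CaseB F (k+1) k s d σ w} * Fintype.card F ^ (k * (2 * d + 1)) ≤ Fintype.card F ^ (k * s + s + k * s) := by
  classical
  rcases isEmpty_or_nonempty {w // CaseB F (k+1) k s d σ w} with hE | ⟨⟨w0, h0⟩⟩
  · simp
  have hσ : Function.Injective σ := by
    intro i j h
    apply h0.2.1
    simp [h]
  have hds : d + 2 ≤ s := by simpa using Fintype.card_le_of_injective σ hσ
  choose t ht using fun w : {w // CaseB F (k+1) k s d σ w} => w.2.2.2
  have hinj : Function.Injective (fun w : {w // CaseB F (k+1) k s d σ w} =>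
      ((w.1.1 (σ 0), w.1.1 (σ 1), t w, fun j : {j // ¬ ∃ i, σ i = j} => w.1.1 j.1, fun j : {j // ¬ ∃ i : Fin (d+1), σ i.castSucc = j} => w.1.2 j.1) :
        (Fin (k+1) → F) × (Fin (k+1) → F) × (Fin d → F) × ({j // ¬ ∃ i, σ i = j} → Fin (k+1) → F) × ({j // ¬ ∃ i : Fin (d+1), σ i.castSucc = j} → Fin k → F))) := by
    intro w w' heq
    simp only [Prod.mk.injEq] at heq
    obtain ⟨e1, e2, e3, e4, e5⟩ := heq
    have hx : w.1.1 = w'.1.1 := by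
      funext j
      by_cases hj : ∃ i, σ i = j
      · obtain ⟨i, rfl⟩ := hj
        induction i using Fin.cases with
        | zero => exact e1
        | succ i =>
          induction i using Fin.cases with
          | zero => exact e2
          | succ i => rw [ht w i, ht w' i, e1, e2, e3]
      · exact congrFun e4 ⟨j, hj⟩
    have ha1 : ∀ j, (¬ ∃ i : Fin (d+1), σ i.castSucc = j) → w.1.2 j = w'.1.2 j := fun j hj => congrFun e5 ⟨j, hj⟩
    have ha : w.1.2 = w'.1.2 := by
      funext j
      by_cases hj : ∃ i : Fin (d+1), σ i.castSucc = j
      · obtain ⟨i, rfl⟩ := hj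
        have hin := w.2.2.1
        obtain ⟨p, hp1, hp2, hp3⟩ := sepPoly ((Finset.univ.erase i).image (fun l : Fin (d+1) => w.1.1 (σ l.castSucc)))
          (w.1.1 (σ i.castSucc)) (by
            simp only [Finset.mem_image, Finset.mem_erase, Finset.mem_univ, and_true, not_exists, not_and]
            intro l hl h
            have := hin h
            exact hl (Fin.castSucc_injective _ this))
        have hpd : p.totalDegree ≤ d := hp1.trans (Finset.card_image_le.trans (by simp))
        have r1 := w.2.1.2 p hpd
        have r2 := w'.2.1.2 p hpd
        rw [← hx] at r2
        have r3 : ∑ j, eval (w.1.1 j) p • (w.1.2 j - w'.1.2 j) = 0 := by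
          simp only [smul_sub, Finset.sum_sub_distrib, r1, r2, sub_zero]
        rw [Finset.sum_eq_single (σ i.castSucc)] at r3
        · exact sub_eq_zero.1 ((smul_eq_zero.1 r3).resolve_left hp2)
        · intro b _ hb
          by_cases hbb : ∃ l : Fin (d+1), σ l.castSucc = b
          · obtain ⟨l, rfl⟩ := hbb
            rw [hp3, zero_smul]
            simp only [Finset.mem_image, Finset.mem_erase, Finset.mem_univ, and_true]
            exact ⟨l, fun h => hb (by rw [h]), rfl⟩
          · rw [ha1 b hbb, sub_self, smul_zero]
        · simp
      · exact ha1 j hj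
    exact Subtype.ext (Prod.ext hx ha)
  have hc1 : Fintype.card {j // ¬ ∃ i, σ i = j} = s - (d + 2) := by
    rw [Fintype.card_subtype_compl, Fintype.card_fin]
    congr 1
    have := Set.card_range_of_injective hσ
    rw [Fintype.card_fin] at this
    rw [← Nat.card_eq_fintype_card] at this ⊢
    exact this
  have hc2 : Fintype.card {j // ¬ ∃ i : Fin (d+1), σ i.castSucc = j} = s - (d + 1) := by
    rw [Fintype.card_subtype_compl, Fintype.card_fin]
    congr 1
    have := Set.card_range_of_injective (hσ.comp (Fin.castSucc_injective (d+1)))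
    rw [Fintype.card_fin] at this
    rw [← Nat.card_eq_fintype_card] at this ⊢
    exact this
  refine (Nat.mul_le_mul_right _ (Nat.card_le_card_of_injective _ hinj)).trans ?_
  simp only [Nat.card_eq_fintype_card, Fintype.card_prod, Fintype.card_fun, Fintype.card_fin, hc1, hc2]
  obtain ⟨r, hr⟩ := Nat.exists_eq_add_of_le hds
  have f1 : s - (d + 2) = r := by omega
  have f2 : s - (d + 1) = r + 1 := by omega
  rw [f1, f2, ← pow_mul, ← pow_mul, ← pow_add, ← pow_add, ← pow_add, ← pow_add, ← pow_add]
  apply le_of_eq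
  congr 1
  rw [hr]; ring

lemma relA_count (k d : ℕ) (hk : 0 < k) (hd : d = (k+1)^2 + 1) : ∃ C : ℕ, ∀ (F : Type) [Field F] [Fintype F],
    Nat.card {w // RelA F (k+1) k (2 * (k * (k+1) + 1)) d w} ≤
      C * Fintype.card F ^ (k * (2 * (k * (k+1) + 1)) + (k * (k+1) + 1)) := by
  classical
  set m := k * (k+1) + 1 with hm
  refine ⟨(2*m)^(2*m) + (2*m)^(d+2), fun F _ _ => ?_⟩
  have hB : ∀ σ, Nat.card {w // CaseB F (k+1) k (2*m) d σ w} ≤ Fintype.card F ^ (k * (2*m) + m) := by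
    intro σ
    have h := caseB_count (F := F) k (2*m) d σ
    have hq : 0 < Fintype.card F := Fintype.card_pos
    refine Nat.le_of_mul_le_mul_right (h.trans ?_) (pow_pos hq (k * (2 * d + 1)))
    rw [← pow_add]
    apply Nat.pow_le_pow_right hq
    rw [hm, hd]
    nlinarith
  have hcov : (Finset.univ.filter fun w => RelA F (k+1) k (2*m) d w) ⊆
     (Finset.univ.biUnion fun φ => Finset.univ.filter fun w => CaseA F (k+1) k (2*m) φ w) ∪
     (Finset.univ.biUnion fun σ => Finset.univ.filter fun w => CaseB F (k+1) k (2*m) d σ w) := by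
    intro w hw
    simp only [Finset.mem_filter, Finset.mem_univ, true_and, Finset.mem_union, Finset.mem_biUnion] at hw ⊢
    exact relA_cases (k+1) k (2*m) d (by rw [hm, hd]; ring_nf; nlinarith) w hw
  have h1 := (Finset.card_le_card hcov).trans ((Finset.card_union_le _ _).trans (add_le_add Finset.card_biUnion_le Finset.card_biUnion_le))
  simp only [← Fintype.card_subtype, ← Nat.card_eq_fintype_card] at h1
  refine h1.trans ?_
  rw [add_mul]
  apply add_le_add
  · refine (Finset.sum_le_sum fun φ _ => caseA_count k m φ).trans ?_
    simp
  · refine (Finset.sum_le_sum fun φ _ => hB φ).trans ?_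
    simp
end

section
open MvPolynomial
lemma char_sum {F : Type*} [Field F] [Fintype F] (ψ : AddChar F ℂ) (hψ : ψ.IsPrimitive)
    {M : Type*} [AddCommGroup M] [Module F M] [Fintype M] (L : M →ₗ[F] F) [Decidable (L = 0)] :
    ∑ m, ψ (L m) = if L = 0 then (Fintype.card M : ℂ) else 0 := by
  classical
  split_ifs with h
  · simp [h]
  · have h1 : ψ.compAddMonoidHom L.toAddMonoidHom ≠ 0 := by
      intro h0
      obtain ⟨m, hm⟩ : ∃ m, L m ≠ 0 := by
        by_contra hcon
        push Not at hcon
        exact h (LinearMap.ext hcon)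
      apply hψ hm
      ext t
      have := DFunLike.congr_fun h0 (t • m)
      simp at this
      rw [AddChar.mulShift_apply, mul_comm]
      simpa using this
    have h2 := AddChar.sum_eq_ite (ψ.compAddMonoidHom L.toAddMonoidHom)
    rw [if_neg h1] at h2
    exact h2

noncomputable def dotL (F : Type*) [Field F] {k : ℕ} (b : Fin k → F) : (Fin k → F) →ₗ[F] F :=
  ∑ i, b i • LinearMap.proj i

lemma dotL_apply (F : Type*) [Field F] {k : ℕ} (b a : Fin k → F) : dotL F b a = ∑ i, b i * a i := by
  simp [dotL]

lemma dotL_zero (F : Type*) [Field F] {k : ℕ} (b : Fin k → F) : dotL F b = 0 ↔ b = 0 := by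
  classical
  constructor
  · intro h
    ext i
    have := LinearMap.congr_fun h (Pi.single i 1)
    rw [dotL_apply] at this
    simpa [Pi.single_apply] using this
  · rintro rfl; simp [dotL]

noncomputable def evL (F : Type*) [Field F] {n k s : ℕ} (d : ℕ) (x : Fin s → Fin n → F) (a : Fin s → Fin k → F) :
    (Fin k → restrictTotalDegree (Fin n) F d) →ₗ[F] F :=
  ∑ j, ∑ i, a j i • ((aeval (R := F) (x j)).toLinearMap ∘ₗ (restrictTotalDegree (Fin n) F d).subtype ∘ₗ LinearMap.proj i)

lemma evL_apply (F : Type*) [Field F] {n k s : ℕ} (d : ℕ) (x : Fin s → Fin n → F) (a : Fin s → Fin k → F)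
    (g : Fin k → restrictTotalDegree (Fin n) F d) :
    evL F d x a g = ∑ j, ∑ i, eval (x j) (g i).1 * a j i := by
  simp [evL, MvPolynomial.aeval_eq_eval, mul_comm]

lemma evL_zero (F : Type*) [Field F] {n k s : ℕ} (d : ℕ) (x : Fin s → Fin n → F) (a : Fin s → Fin k → F)
    (h : evL F d x a = 0) (p : MvPolynomial (Fin n) F) (hp : p.totalDegree ≤ d) :
    ∑ j, eval (x j) p • a j = 0 := by
  classical
  ext i
  have := LinearMap.congr_fun h (Pi.single i ⟨p, (mem_restrictTotalDegree _ _ _).2 hp⟩)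
  rw [evL_apply] at this
  simp only [LinearMap.zero_apply] at this
  rw [Finset.sum_apply, Pi.zero_apply, ← this]
  apply Finset.sum_congr rfl
  intro j _
  rw [Finset.sum_eq_single i]
  · simp
  · intro b _ hb
    rw [Pi.single_eq_of_ne hb]; simp
  · simp

lemma moment (k s d : ℕ) (F : Type) [Field F] [Fintype F] [Fintype (restrictTotalDegree (Fin (k+1)) F d)] :
    ∑ g : Fin k → restrictTotalDegree (Fin (k+1)) F d,
      ((Fintype.card F : ℤ) ^ k * ((Nat.card {x : Fin (k+1) → F // ∀ i, eval x (g i).1 = 0} : ℤ) - Fintype.card F)) ^ s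
    ≤ (Nat.card (restrictTotalDegree (Fin (k+1)) F d) : ℤ) ^ k * Nat.card {w // RelA F (k+1) k s d w} := by
  classical
  obtain ⟨ψ, hψ⟩ : ∃ ψ : AddChar F ℂ, ψ.IsPrimitive :=
    ⟨_, (AddChar.FiniteField.primitiveChar_to_Complex_isPrimitive F)⟩
  set q := Fintype.card F with hq
  have hZ : ∀ g : Fin k → (restrictTotalDegree (Fin (k+1)) F d), ((q : ℂ) ^ k * ((Nat.card {x : Fin (k+1) → F // ∀ i, eval x (g i).1 = 0} : ℂ) - q)) =
      ∑ ω : (Fin (k+1) → F) × {a : Fin k → F // a ≠ 0}, ψ (∑ i, eval ω.1 (g i).1 * ω.2.1 i) := by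
    intro g
    rw [Fintype.sum_prod_type]
    have h1 : ∀ x : Fin (k+1) → F, ∑ a : {a : Fin k → F // a ≠ 0}, ψ (∑ i, eval x (g i).1 * a.1 i) =
        (if ∀ i, eval x (g i).1 = 0 then (q : ℂ) ^ k else 0) - 1 := by
      intro x
      have h2 := char_sum ψ hψ (dotL F (fun i => eval x (g i).1))
      simp only [dotL_apply, dotL_zero] at h2
      have h3 := Fintype.sum_eq_add_sum_subtype_ne (fun a : Fin k → F => ψ (∑ i, eval x (g i).1 * a i)) 0
      rw [h2] at h3
      simp only [Pi.zero_apply, mul_zero, Finset.sum_const_zero, AddChar.map_zero_eq_one] at h3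
      rw [eq_sub_iff_add_eq', ← h3]
      simp [funext_iff, hq]
    rw [Finset.sum_congr rfl (fun x _ => h1 x), Finset.sum_sub_distrib, ← Finset.sum_filter]
    simp only [Finset.sum_const, Nat.card_eq_fintype_card, Fintype.card_subtype]
    simp [← hq]
    ring
  have hsum : ∑ g : Fin k → (restrictTotalDegree (Fin (k+1)) F d), ((q : ℂ) ^ k * ((Nat.card {x : Fin (k+1) → F // ∀ i, eval x (g i).1 = 0} : ℂ) - q)) ^ s
     = ∑ w : Fin s → (Fin (k+1) → F) × {a : Fin k → F // a ≠ 0},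
        if evL F d (fun j => (w j).1) (fun j => (w j).2.1) = 0 then (Nat.card (restrictTotalDegree (Fin (k+1)) F d) : ℂ) ^ k else 0 := by
    simp only [hZ, Fintype.sum_pow]
    rw [Finset.sum_comm]
    apply Finset.sum_congr rfl
    intro w _
    have h4 := char_sum ψ hψ (evL F d (fun j => (w j).1) (fun j => (w j).2.1))
    simp only [evL_apply, Fintype.card_fun, Fintype.card_fin] at h4
    rw [← Nat.card_eq_fintype_card] at h4
    push_cast at h4
    rw [← h4]
    apply Finset.sum_congr rfl
    intro g _
    have := map_prod ψ.toMonoidHom (fun j => Multiplicative.ofAdd (∑ i, eval (w j).1 (g i).1 * (w j).2.1 i)) Finset.univ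
    rw [← ofAdd_sum] at this
    exact this.symm
  rw [← Finset.sum_filter, Finset.sum_const, nsmul_eq_mul, mul_comm] at hsum
  have hint : ∑ g : Fin k → (restrictTotalDegree (Fin (k+1)) F d),
      ((q : ℤ) ^ k * ((Nat.card {x : Fin (k+1) → F // ∀ i, eval x (g i).1 = 0} : ℤ) - q)) ^ s =
      (Nat.card (restrictTotalDegree (Fin (k+1)) F d) : ℤ) ^ k * ((Finset.univ.filter fun w : Fin s → (Fin (k+1) → F) × {a : Fin k → F // a ≠ 0} =>
        evL F d (fun j => (w j).1) (fun j => (w j).2.1) = 0).card : ℤ) := by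
    exact_mod_cast hsum
  rw [hint]
  gcongr
  rw [Nat.card_eq_fintype_card, Fintype.card_subtype]
  apply Finset.card_le_card_of_injOn (fun w => (fun j => (w j).1, fun j => (w j).2.1))
  · intro w hw
    simp only [Finset.coe_filter, Finset.mem_univ, true_and, Set.mem_ofPred_eq] at hw ⊢
    exact ⟨fun j => (w j).2.2, fun p hp => evL_zero F d _ _ hw p hp⟩
  · intro w _ w' _ h
    simp only [Prod.mk.injEq] at h
    funext j
    exact Prod.ext (congrFun h.1 j) (Subtype.ext (congrFun h.2 j))

lemma lemmaA (k d : ℕ) (hk : 0 < k) (hd : d = (k+1)^2+1) : ∃ C : ℕ, ∀ (F : Type) [Field F] [Fintype F],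
    Nat.card {g : Fin k → restrictTotalDegree (Fin (k+1)) F d //
      2 * Nat.card {x : Fin (k+1) → F // ∀ i, eval x (g i).1 = 0} < Fintype.card F} * Fintype.card F ^ (k * (k+1) + 1) ≤
      C * Nat.card (restrictTotalDegree (Fin (k+1)) F d) ^ k := by
  classical
  obtain ⟨C, hC⟩ := relA_count k d hk hd
  refine ⟨2 ^ (2 * (k * (k+1) + 1)) * C, fun F _ _ => ?_⟩
  have hfin : Finite (restrictTotalDegree (Fin (k+1)) F d) := Module.finite_of_finite F
  have := Fintype.ofFinite (restrictTotalDegree (Fin (k+1)) F d)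
  have hC := hC F
  set m := k * (k+1) + 1 with hm
  have hM := moment k (2 * m) d F
  set q := Fintype.card F with hq
  set B := Finset.univ.filter (fun g : Fin k → (restrictTotalDegree (Fin (k+1)) F d) => 2 * Nat.card {x : Fin (k+1) → F // ∀ i, eval x (g i).1 = 0} < q) with hB
  have hBc : Nat.card {g : Fin k → (restrictTotalDegree (Fin (k+1)) F d) // 2 * Nat.card {x : Fin (k+1) → F // ∀ i, eval x (g i).1 = 0} < q} = B.card := by
    rw [Nat.card_eq_fintype_card, Fintype.card_subtype]
  rw [hBc]
  have h1 : (B.card : ℤ) * ((q:ℤ) ^ (k+1)) ^ (2*m) ≤ 2 ^ (2*m) * ∑ g : Fin k → (restrictTotalDegree (Fin (k+1)) F d),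
      ((q : ℤ) ^ k * ((Nat.card {x : Fin (k+1) → F // ∀ i, eval x (g i).1 = 0} : ℤ) - q)) ^ (2*m) := by
    rw [Finset.mul_sum]
    calc (B.card : ℤ) * ((q:ℤ) ^ (k+1)) ^ (2*m) = ∑ g ∈ B, ((q:ℤ) ^ (k+1)) ^ (2*m) := by simp
      _ ≤ ∑ g ∈ B, 2 ^ (2*m) * ((q : ℤ) ^ k * ((Nat.card {x : Fin (k+1) → F // ∀ i, eval x (g i).1 = 0} : ℤ) - q)) ^ (2*m) := by
          apply Finset.sum_le_sum
          intro g hg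
          rw [hB, Finset.mem_filter] at hg
          have hg := hg.2
          generalize Nat.card {x : Fin (k+1) → F // ∀ i, eval x (g i).1 = 0} = N at hg
          have e : (2:ℤ) ^ (2*m) * ((q : ℤ) ^ k * ((N : ℤ) - q)) ^ (2*m) = ((q : ℤ) ^ k * (2 * (q - N))) ^ (2*m) := by
            rw [← mul_pow, pow_mul, pow_mul]
            congr 1
            ring
          rw [e]
          apply pow_le_pow_left₀ (by positivity)
          rw [pow_succ]
          apply mul_le_mul_of_nonneg_left _ (by positivity)
          zify at hg
          linarith
      _ ≤ _ := by
          apply Finset.sum_le_sum_of_subset_of_nonneg (Finset.subset_univ _)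
          intro g _ _
          apply mul_nonneg (by positivity)
          rw [pow_mul]
          positivity
  have h2 : (B.card : ℤ) * ((q:ℤ) ^ (k+1)) ^ (2*m) ≤ 2 ^ (2*m) * ((Nat.card (restrictTotalDegree (Fin (k+1)) F d) : ℤ) ^ k * (C * q ^ (k * (2*m) + m))) := by
    refine h1.trans ?_
    apply mul_le_mul_of_nonneg_left _ (by positivity)
    refine hM.trans ?_
    apply mul_le_mul_of_nonneg_left _ (by positivity)
    exact_mod_cast hC
  have h3 : B.card * q ^ m * q ^ (k * (2*m) + m) ≤ 2 ^ (2*m) * C * Nat.card (restrictTotalDegree (Fin (k+1)) F d) ^ k * q ^ (k * (2*m) + m) := by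
    zify
    convert h2 using 1
    · rw [← pow_mul, mul_assoc, ← pow_add]; congr 2; ring
    · ring
  exact Nat.le_of_mul_le_mul_right h3 (pow_pos Fintype.card_pos _)
end

open MvPolynomial

lemma fiber_bound {V : Type*} [Finite V] (N r : ℕ) (B : (Fin r → V) → Prop) (e : Fin r → Fin N)
    (he : Function.Injective e) :
    Nat.card {f : Fin N → V // B (f ∘ e)} * Nat.card V ^ r ≤ Nat.card {g // B g} * Nat.card V ^ N := by
  classical
  have h1 : ∀ t : ℕ, Nat.card V ^ t = Nat.card (Fin t → V) := by
    intro t; rw [Nat.card_fun, Nat.card_eq_fintype_card (α := Fin t), Fintype.card_fin]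
  rw [h1, h1, ← Nat.card_prod, ← Nat.card_prod]
  apply Nat.card_le_card_of_injective (fun p : {f : Fin N → V // B (f ∘ e)} × (Fin r → V) =>
    ((⟨p.1.1 ∘ e, p.1.2⟩, Function.extend e p.2 p.1.1) : {g // B g} × (Fin N → V)))
  rintro ⟨⟨f, hf⟩, h⟩ ⟨⟨f', hf'⟩, h'⟩ heq
  simp only [Prod.mk.injEq, Subtype.mk.injEq] at heq ⊢
  obtain ⟨e1, e2⟩ := heq
  have hh : h = h' := by
    funext i
    have := congrFun e2 (e i)
    rwa [he.extend_apply, he.extend_apply] at this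
  refine ⟨?_, hh⟩
  funext j
  by_cases hj : ∃ i, e i = j
  · obtain ⟨i, rfl⟩ := hj
    exact congrFun e1 i
  · have := congrFun e2 j
    rwa [Function.extend_apply' _ _ _ hj, Function.extend_apply' _ _ _ hj] at this

lemma union_bound {V : Type*} [Finite V] [Nonempty V] (N r q m C : ℕ) (hq : 0 < q) (B : (Fin r → V) → Prop)
    (hB : Nat.card {g // B g} * q ^ (m + 1) ≤ C * Nat.card V ^ r) (hN : N ^ r ≤ q ^ m) :
    Nat.card {f : Fin N → V // ∃ e : Fin r → Fin N, Function.Injective e ∧ B (f ∘ e)} * q ≤ C * Nat.card V ^ N := by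
  classical
  have := Fintype.ofFinite V
  have hV : 0 < Nat.card V := Nat.card_pos
  have h1 : Nat.card {f : Fin N → V // ∃ e : Fin r → Fin N, Function.Injective e ∧ B (f ∘ e)} ≤
      ∑ e : Fin r → Fin N, if Function.Injective e then Nat.card {f : Fin N → V // B (f ∘ e)} else 0 := by
    rw [← Finset.sum_filter, Nat.card_eq_fintype_card, Fintype.card_subtype]
    refine le_trans (Finset.card_le_card (t := (Finset.univ.filter fun e : Fin r → Fin N => Function.Injective e).biUnion
      fun e => Finset.univ.filter fun f : Fin N → V => B (f ∘ e)) ?_) (Finset.card_biUnion_le.trans ?_)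
    · intro f hf
      simpa using hf
    · apply Finset.sum_le_sum
      intro e _
      rw [Nat.card_eq_fintype_card, Fintype.card_subtype]
  have h2 : (∑ e : Fin r → Fin N, if Function.Injective e then Nat.card {f : Fin N → V // B (f ∘ e)} else 0) * Nat.card V ^ r ≤
      N ^ r * (Nat.card {g // B g} * Nat.card V ^ N) := by
    rw [Finset.sum_mul]
    refine (Finset.sum_le_sum (g := fun _ => Nat.card {g // B g} * Nat.card V ^ N) ?_).trans ?_
    · intro e _
      split_ifs with he
      · exact fiber_bound N r B e he
      · simp
    · simp
  generalize (∑ e : Fin r → Fin N, if Function.Injective e then Nat.card {f : Fin N → V // B (f ∘ e)} else 0) = S at h1 h2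
  refine (Nat.mul_le_mul_right q h1).trans ?_
  generalize Nat.card {g // B g} = b at hB h2
  generalize Nat.card V = v at *
  apply Nat.le_of_mul_le_mul_right _ (show 0 < v ^ r * q ^ m by positivity)
  calc S * q * (v ^ r * q ^ m) = (S * v ^ r) * q ^ (m+1) := by ring
    _ ≤ (N ^ r * (b * v ^ N)) * q ^ (m+1) := Nat.mul_le_mul_right _ h2
    _ = N ^ r * v ^ N * (b * q ^ (m+1)) := by ring
    _ ≤ q ^ m * v ^ N * (C * v ^ r) := Nat.mul_le_mul (Nat.mul_le_mul_right _ hN) hB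
    _ = _ := by ring

/-- Fix `k` and set `d = (k+1)² + 1`. For every `ε > 0` there is `Q` such
that for every finite field `F` of order `q = Fintype.card F ≥ Q`, with `n = q^(k+1)`: if
`f_1, …, f_n` are chosen independently and uniformly at random among polynomials in `k+1`
variables of total degree at most `d`, then with probability at least `1 − ε` both hold:
(i) for every `k`-element subset `T ⊆ {1,…,n}` the number of common zeros in `F^(k+1)` of
`{f_i : i ∈ T}` is at least `q/2`; and (ii) for every `(k+1)`-element subset `T` that number
is at most `d^(k+1)`. The probability is expressed as counts: the number of tuples realizing
the event is at least `(1 − ε)` times the total number of tuples. -/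
theorem statement_16 (k : ℕ) (hk : 0 < k) (d : ℕ) (hd : d = (k + 1) ^ 2 + 1) :
    ∀ ε : ℝ, 0 < ε → ∃ Q : ℕ, ∀ (F : Type) [Field F] [Fintype F],
      Q ≤ Fintype.card F →
      (1 - ε) *
          (Nat.card {f : Fin (Fintype.card F ^ (k + 1)) →
              MvPolynomial (Fin (k + 1)) F //
            ∀ j, (f j).totalDegree ≤ d} : ℝ) ≤
        (Nat.card {f : Fin (Fintype.card F ^ (k + 1)) →
            MvPolynomial (Fin (k + 1)) F //
          (∀ j, (f j).totalDegree ≤ d) ∧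
          (∀ T : Finset (Fin (Fintype.card F ^ (k + 1))), T.card = k →
            (Fintype.card F : ℝ) / 2 ≤
              (Nat.card {x : Fin (k + 1) → F //
                ∀ i ∈ T, MvPolynomial.eval x (f i) = 0} : ℝ)) ∧
          (∀ T : Finset (Fin (Fintype.card F ^ (k + 1))), T.card = k + 1 →
            Nat.card {x : Fin (k + 1) → F //
              ∀ i ∈ T, MvPolynomial.eval x (f i) = 0} ≤ d ^ (k + 1))} : ℝ) := by
  classical
  intro ε hε
  obtain ⟨CA, hCA⟩ := lemmaA k d hk hd
  obtain ⟨CB, hCB⟩ := lemmaB (k+1) d (by omega) (by omega)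
  obtain ⟨Q, hQ⟩ := exists_nat_ge ((CA + CB : ℝ) / ε)
  refine ⟨Q, fun F _ _ hF => ?_⟩
  have hCA := hCA F
  have hCB := hCB F
  have hfin : Finite (restrictTotalDegree (Fin (k+1)) F d) := rtd_finite F (k+1) d
  have hq : 0 < Fintype.card F := Fintype.card_pos
  have uA := union_bound (Fintype.card F ^ (k+1)) k (Fintype.card F) (k * (k+1)) CA hq _ hCA
    (by rw [← pow_mul, mul_comm])
  have uB := union_bound (Fintype.card F ^ (k+1)) (k+1) (Fintype.card F) d CB hq _ hCB
    (by rw [← pow_mul]; apply Nat.pow_le_pow_right hq; rw [hd]; nlinarith)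
  generalize hN : Fintype.card F ^ (k+1) = N at uA uB ⊢
  let PA : (Fin N → restrictTotalDegree (Fin (k+1)) F d) → Prop := fun f => ∃ e : Fin k → Fin N, Function.Injective e ∧
    2 * Nat.card {x : Fin (k+1) → F // ∀ i, eval x ((f ∘ e) i).1 = 0} < Fintype.card F
  let PB : (Fin N → restrictTotalDegree (Fin (k+1)) F d) → Prop := fun f => ∃ e : Fin (k+1) → Fin N, Function.Injective e ∧
    d ^ (k+1) < Nat.card {x : Fin (k+1) → F // ∀ i, eval x ((f ∘ e) i).1 = 0}
  have hTot : Nat.card {f : Fin N → MvPolynomial (Fin (k + 1)) F // ∀ j, (f j).totalDegree ≤ d} =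
      Nat.card (restrictTotalDegree (Fin (k+1)) F d) ^ N := by
    have : Nat.card (restrictTotalDegree (Fin (k+1)) F d) ^ N = Nat.card (Fin N → restrictTotalDegree (Fin (k+1)) F d) := by
      rw [Nat.card_fun, Nat.card_eq_fintype_card (α := Fin N), Fintype.card_fin]
    rw [this]
    apply Nat.card_congr
    exact
      { toFun := fun f j => ⟨f.1 j, (mem_restrictTotalDegree _ _ _).2 (f.2 j)⟩
        invFun := fun f => ⟨fun j => (f j).1, fun j => (mem_restrictTotalDegree _ _ _).1 (f j).2⟩
        left_inv := fun f => rfl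
        right_inv := fun f => rfl }
  have hsplit : Nat.card (restrictTotalDegree (Fin (k+1)) F d) ^ N ≤
      Nat.card {f // ¬ PA f ∧ ¬ PB f} + (Nat.card {f // PA f} + Nat.card {f // PB f}) := by
    have := Fintype.ofFinite (restrictTotalDegree (Fin (k+1)) F d)
    have e : Nat.card (restrictTotalDegree (Fin (k+1)) F d) ^ N = (Finset.univ : Finset (Fin N → restrictTotalDegree (Fin (k+1)) F d)).card := by simp
    rw [e]
    simp only [Nat.card_eq_fintype_card, Fintype.card_subtype]
    refine le_trans (Finset.card_le_card (t := (Finset.univ.filter fun f => ¬ PA f ∧ ¬ PB f) ∪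
      ((Finset.univ.filter fun f => PA f) ∪ (Finset.univ.filter fun f => PB f))) ?_) ?_
    · intro f _
      simp only [Finset.mem_union, Finset.mem_filter, Finset.mem_univ, true_and]
      by_cases hA : PA f
      · exact Or.inr (Or.inl hA)
      · by_cases hB : PB f
        · exact Or.inr (Or.inr hB)
        · exact Or.inl ⟨hA, hB⟩
    · exact (Finset.card_union_le _ _).trans (add_le_add le_rfl (Finset.card_union_le _ _))
  have hT : ∀ (f : Fin N → restrictTotalDegree (Fin (k+1)) F d) (r : ℕ) (T : Finset (Fin N)), T.card = r →
      ∃ e : Fin r → Fin N, Function.Injective e ∧ Nat.card {x : Fin (k+1) → F // ∀ i ∈ T, eval x (f i).1 = 0} =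
        Nat.card {x : Fin (k+1) → F // ∀ i, eval x ((f ∘ e) i).1 = 0} := by
    intro f r T hr
    refine ⟨T.orderEmbOfFin hr, (T.orderEmbOfFin hr).injective, ?_⟩
    apply Nat.card_congr
    apply Equiv.subtypeEquivRight
    intro x
    constructor
    · intro h i
      exact h _ (T.orderEmbOfFin_mem hr i)
    · intro h i hi
      have : i ∈ Set.range (T.orderEmbOfFin hr) := by rw [Finset.range_orderEmbOfFin]; exact hi
      obtain ⟨j, rfl⟩ := this
      exact h j
  have hGood : Nat.card {f // ¬ PA f ∧ ¬ PB f} ≤ Nat.card {f : Fin N → MvPolynomial (Fin (k + 1)) F //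
          (∀ j, (f j).totalDegree ≤ d) ∧
          (∀ T : Finset (Fin N), T.card = k →
            (Fintype.card F : ℝ) / 2 ≤
              (Nat.card {x : Fin (k + 1) → F //
                ∀ i ∈ T, MvPolynomial.eval x (f i) = 0} : ℝ)) ∧
          (∀ T : Finset (Fin N), T.card = k + 1 →
            Nat.card {x : Fin (k + 1) → F //
              ∀ i ∈ T, MvPolynomial.eval x (f i) = 0} ≤ d ^ (k + 1))} := by
    have hfinG : Finite {f : Fin N → MvPolynomial (Fin (k + 1)) F //
          (∀ j, (f j).totalDegree ≤ d) ∧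
          (∀ T : Finset (Fin N), T.card = k →
            (Fintype.card F : ℝ) / 2 ≤
              (Nat.card {x : Fin (k + 1) → F //
                ∀ i ∈ T, MvPolynomial.eval x (f i) = 0} : ℝ)) ∧
          (∀ T : Finset (Fin N), T.card = k + 1 →
            Nat.card {x : Fin (k + 1) → F //
              ∀ i ∈ T, MvPolynomial.eval x (f i) = 0} ≤ d ^ (k + 1))} := by
      apply Finite.of_injective (β := Fin N → restrictTotalDegree (Fin (k+1)) F d)
        (fun f j => ⟨f.1 j, (mem_restrictTotalDegree _ _ _).2 (f.2.1 j)⟩)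
      intro f f' h
      apply Subtype.ext
      funext j
      exact congrArg Subtype.val (congrFun h j)
    have key : ∀ f, ¬ PA f ∧ ¬ PB f → (∀ j, (f j).1.totalDegree ≤ d) ∧
          (∀ T : Finset (Fin N), T.card = k →
            (Fintype.card F : ℝ) / 2 ≤
              (Nat.card {x : Fin (k + 1) → F //
                ∀ i ∈ T, MvPolynomial.eval x (f i).1 = 0} : ℝ)) ∧
          (∀ T : Finset (Fin N), T.card = k + 1 →
            Nat.card {x : Fin (k + 1) → F //
              ∀ i ∈ T, MvPolynomial.eval x (f i).1 = 0} ≤ d ^ (k + 1)) := by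
      rintro f ⟨hA, hB⟩
      refine ⟨fun j => (mem_restrictTotalDegree _ _ _).1 (f j).2, ?_, ?_⟩
      · intro T hTk
        obtain ⟨e, he, hc⟩ := hT f k T hTk
        rw [hc]
        by_contra hcon
        apply hA
        refine ⟨e, he, ?_⟩
        push Not at hcon
        have : (2 : ℝ) * Nat.card {x : Fin (k+1) → F // ∀ i, eval x ((f ∘ e) i).1 = 0} < Fintype.card F := by linarith
        exact_mod_cast this
      · intro T hTk
        obtain ⟨e, he, hc⟩ := hT f (k+1) T hTk
        rw [hc]
        by_contra hcon
        push Not at hcon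
        exact hB ⟨e, he, hcon⟩
    apply Nat.card_le_card_of_injective (fun f => ⟨fun j => (f.1 j).1, key f.1 f.2⟩)
    intro f f' h
    apply Subtype.ext
    funext j
    exact Subtype.ext (congrFun (Subtype.mk.inj h) j)
  rw [hTot]
  refine le_trans ?_ (Nat.cast_le.2 hGood)
  have uA' : Nat.card {f // PA f} * Fintype.card F ≤ CA * Nat.card (restrictTotalDegree (Fin (k+1)) F d) ^ N := uA
  have uB' : Nat.card {f // PB f} * Fintype.card F ≤ CB * Nat.card (restrictTotalDegree (Fin (k+1)) F d) ^ N := uB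
  generalize Nat.card {f // PA f} = bA at *
  generalize Nat.card {f // PB f} = bB at *
  generalize Nat.card {f // ¬ PA f ∧ ¬ PB f} = G at *
  generalize Nat.card (restrictTotalDegree (Fin (k+1)) F d) ^ N = T at *
  generalize Fintype.card F = q at *
  have hq' : (0 : ℝ) < q := by exact_mod_cast hq
  have hqQ : (Q : ℝ) ≤ q := by exact_mod_cast hF
  have h1 : (CA + CB : ℝ) ≤ q * ε := by
    rw [← div_le_iff₀ hε]; exact hQ.trans hqQ
  have h2 : (T : ℝ) ≤ G + (bA + bB) := by exact_mod_cast hsplit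
  have h3 : (bA : ℝ) * q ≤ CA * T := by exact_mod_cast uA'
  have h4 : (bB : ℝ) * q ≤ CB * T := by exact_mod_cast uB'
  have h5 : ((bA : ℝ) + bB) * q ≤ (ε * T) * q := by
    have : (0 : ℝ) ≤ T := Nat.cast_nonneg _
    have := mul_le_mul_of_nonneg_right h1 this
    linarith
  have h6 := le_of_mul_le_mul_right h5 hq'
  linarith
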